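/- arXiv:math/0107013 — 2 statements merged into one kernel-verified Lean document; each statement's English description precedes it below -/
import Mathlib

section
/- Let Q and Q′ be normal coordinates for germs at 0 of real-analytic hypersurfaces M, M′ ⊂ ℂ², neither Levi-flat near 0. If H¹ and H² are local biholomorphisms (ℂ²,0) → (ℂ²,0), each satisfying the mapping identity for (Q,Q′), and their Jacobian matrices at the origin agree, (H¹)′(0) = (H²)′(0), then H¹(z,0) = H²(z,0) for all z ∈ ℂ near 0; that is, a local biholomorphism sending M into M′ is completely determined along the zero Segre variety {w = 0} by its 1-jet at 0. -/
open Filter Topology Matrix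

noncomputable section

/-- Complex conjugation as a plain function. -/
def cj : ℂ → ℂ := (starRingEnd ℂ)

/-- Iterated partial derivative `∂_z^i ∂_w^j F (z, w)` of `F : ℂ → ℂ → ℂ`. -/
def pd (F : ℂ → ℂ → ℂ) (i j : ℕ) (z w : ℂ) : ℂ :=
  deriv^[i] (fun z' => deriv^[j] (F z') w) z

/-- `Q` is a normal-coordinates defining function (near `0`) of a germ of a
real-analytic hypersurface in `ℂ²`. -/
def IsNormalCoord (Q : ℂ → ℂ → ℂ → ℂ) : Prop :=
  AnalyticAt ℂ (fun p : ℂ × ℂ × ℂ => Q p.1 p.2.1 p.2.2) 0 ∧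
  (∀ᶠ p : ℂ × ℂ in 𝓝 0, Q p.1 0 p.2 = p.2) ∧
  (∀ᶠ p : ℂ × ℂ in 𝓝 0, Q 0 p.1 p.2 = p.2) ∧
  (∀ᶠ p : ℂ × ℂ × ℂ in 𝓝 0, Q p.1 p.2.1 (cj (Q (cj p.2.1) (cj p.1) (cj p.2.2))) = p.2.2)

/-- The mapping identity expressing that the germ at `0` of the holomorphic map
`H = (F, G)` (with `H(0) = 0`) sends the hypersurface defined by `Q` into the one
defined by `Q'`. -/
def SendsInto (Q Q' : ℂ → ℂ → ℂ → ℂ) (F G : ℂ → ℂ → ℂ) : Prop :=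
  AnalyticAt ℂ (fun p : ℂ × ℂ => F p.1 p.2) 0 ∧
  AnalyticAt ℂ (fun p : ℂ × ℂ => G p.1 p.2) 0 ∧
  F 0 0 = 0 ∧ G 0 0 = 0 ∧
  ∀ᶠ p : ℂ × ℂ × ℂ in 𝓝 0,
    G p.1 (Q p.1 p.2.1 p.2.2) =
      Q' (F p.1 (Q p.1 p.2.1 p.2.2)) (cj (F (cj p.2.1) (cj p.2.2))) (cj (G (cj p.2.1) (cj p.2.2)))

/-- Determinant of the Jacobian matrix of `H = (F, G)` at `0`. -/
def JacDet (F G : ℂ → ℂ → ℂ) : ℂ :=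
  pd F 1 0 0 0 * pd G 0 1 0 0 - pd F 0 1 0 0 * pd G 1 0 0 0

/-- The hypersurface defined by `Q` is not Levi-flat near `0`, i.e. `Q(z,χ,τ) ≢ τ`. -/
def NotLeviFlat (Q : ℂ → ℂ → ℂ → ℂ) : Prop :=
  ¬ ∀ᶠ p : ℂ × ℂ × ℂ in 𝓝 0, Q p.1 p.2.1 p.2.2 = p.2.2

/-- The hypersurface defined by `Q` is of finite type at `0`, i.e. `Q(z,χ,0) ≢ 0`. -/
def FiniteTypeAt (Q : ℂ → ℂ → ℂ → ℂ) : Prop :=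
  ¬ ∀ᶠ p : ℂ × ℂ in 𝓝 0, Q p.1 p.2 0 = 0

/-- `q_{αμ}(χ) = ∂_z^α ∂_τ^μ Q(0, χ, 0)`. -/
def qd (Q : ℂ → ℂ → ℂ → ℂ) (α μ : ℕ) (χ : ℂ) : ℂ :=
  deriv^[α] (fun z => deriv^[μ] (fun τ => Q z χ τ) 0) 0

/-- The hypersurface (germ) defined by `Q` as a subset of `ℂ²`. -/
def MSet (Q : ℂ → ℂ → ℂ → ℂ) : Set (ℂ × ℂ) := {p | p.2 = Q p.1 (cj p.1) (cj p.2)}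

open Asymptotics

section Hadamard

variable {E : Type*} [NormedAddCommGroup E] [NormedSpace ℂ E]

/-- The derivative of `A : E × ℂ → ℂ` in the last variable. -/
def sndDeriv (A : E × ℂ → ℂ) (q : E × ℂ) : ℂ := fderiv ℂ A q (0, 1)

lemma AnalyticOnNhd.sndDeriv {A : E × ℂ → ℂ} {s : Set (E × ℂ)} (hA : AnalyticOnNhd ℂ A s) :
    AnalyticOnNhd ℂ (sndDeriv A) s := fun q hq =>
  ((ContinuousLinearMap.apply ℂ ℂ ((0, 1) : E × ℂ)).analyticAt _).comp (hA.fderiv q hq)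

lemma AnalyticOnNhd.sndDeriv_iterate {A : E × ℂ → ℂ} {s : Set (E × ℂ)}
    (hA : AnalyticOnNhd ℂ A s) (k : ℕ) : AnalyticOnNhd ℂ (_root_.sndDeriv^[k] A) s := by
  induction k with
  | zero => exact hA
  | succ k ih => rw [Function.iterate_succ_apply']; exact ih.sndDeriv

lemma AnalyticAt.hasDerivAt_snd {A : E × ℂ → ℂ} {p : E} {t : ℂ} (hA : AnalyticAt ℂ A (p, t)) :
    HasDerivAt (fun w => A (p, w)) (sndDeriv A (p, t)) t :=
  hA.differentiableAt.hasFDerivAt.comp_hasDerivAt t ((hasDerivAt_const t p).prodMk (hasDerivAt_id t))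

lemma isLittleO_sub_leading_term (m : ℕ) : ∀ {A : E × ℂ → ℂ} {r : ℝ},
    AnalyticOnNhd ℂ A (Metric.ball 0 r) →
    (∀ k < m, ∀ p ∈ Metric.ball (0 : E) r, sndDeriv^[k] A (p, 0) = 0) →
    ∀ p₀ ∈ Metric.ball (0 : E) r,
    (fun q : E × ℂ => A q - q.2 ^ m / (m.factorial : ℂ) * sndDeriv^[m] A (q.1, 0))
      =o[𝓝 (p₀, 0)] fun q => q.2 ^ m := by
  induction m with
  | zero =>
    intro A r hA _ p₀ hp₀
    have hmem : ((p₀, 0) : E × ℂ) ∈ Metric.ball (0 : E × ℂ) r := by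
      simpa [Prod.norm_def] using hp₀
    have hc := (hA _ hmem).continuousAt
    have h2 : Tendsto (fun q : E × ℂ => A (q.1, 0)) (𝓝 (p₀, 0)) (𝓝 (A (p₀, 0))) :=
      hc.tendsto.comp (Continuous.tendsto' (by fun_prop) _ _ rfl)
    simpa [isLittleO_one_iff] using hc.tendsto.sub h2
  | succ m ih =>
    intro A r hA hz p₀ hp₀
    have hr : 0 < r := (norm_nonneg _).trans_lt (mem_ball_zero_iff.1 hp₀)
    have hD := ih hA.sndDeriv (fun k hk p hp => hz (k + 1) (by omega) p hp) p₀ hp₀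
    rw [isLittleO_iff] at hD ⊢
    intro c hc
    have hmem : ((p₀, 0) : E × ℂ) ∈ Metric.ball (0 : E × ℂ) r := by
      simpa [Prod.norm_def] using hp₀
    obtain ⟨δ, hδ, hb⟩ := Metric.eventually_nhds_iff_ball.1
      ((hD hc).and (Metric.isOpen_ball.mem_nhds hmem))
    filter_upwards [Metric.ball_mem_nhds _ hδ] with q hq
    obtain ⟨p, w⟩ := q
    have hpw : dist p p₀ < δ ∧ ‖w‖ < δ := by simpa [Prod.dist_eq] using hq
    have key : ∀ t ∈ Metric.closedBall (0 : ℂ) ‖w‖, (p, t) ∈ Metric.ball ((p₀, 0) : E × ℂ) δ := by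
      intro t ht
      simpa [Prod.dist_eq] using ⟨hpw.1, (mem_closedBall_zero_iff.1 ht).trans_lt hpw.2⟩
    have hp : p ∈ Metric.ball (0 : E) r := by
      have := (hb _ (key 0 (by simp))).2
      simpa [Prod.norm_def] using this
    have hfac : ((m + 1).factorial : ℂ) = (m + 1) * m.factorial := by
      push_cast [Nat.factorial_succ]; ring
    have hm0 : (m.factorial : ℂ) ≠ 0 := by exact_mod_cast m.factorial_ne_zero
    have hm1 : (m + 1 : ℂ) ≠ 0 := by exact_mod_cast m.succ_ne_zero
    set κ := sndDeriv^[m + 1] A (p, 0) with hκ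
    have hder : ∀ t ∈ Metric.closedBall (0 : ℂ) ‖w‖, HasDerivWithinAt
        (fun t => A (p, t) - t ^ (m + 1) / ((m + 1).factorial : ℂ) * κ)
        (sndDeriv A (p, t) - t ^ m / (m.factorial : ℂ) * κ) (Metric.closedBall (0 : ℂ) ‖w‖) t := by
      intro t ht
      have h1 := (hA _ (hb _ (key t ht)).2).hasDerivAt_snd
      have h2 := (((hasDerivAt_pow (m + 1) t).div_const ((m + 1).factorial : ℂ)).mul_const κ)
      refine ((h1.sub h2).congr_deriv ?_).hasDerivWithinAt
      rw [hfac]; push_cast; field_simp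
    have hbd : ∀ t ∈ Metric.closedBall (0 : ℂ) ‖w‖,
        ‖sndDeriv A (p, t) - t ^ m / (m.factorial : ℂ) * κ‖ ≤ c * ‖w‖ ^ m := by
      intro t ht
      refine (hb _ (key t ht)).1.trans ?_
      rw [norm_pow]
      gcongr
      exact mem_closedBall_zero_iff.1 ht
    have := (convex_closedBall (0 : ℂ) ‖w‖).norm_image_sub_le_of_norm_hasDerivWithin_le hder hbd
      (x := 0) (y := w) (by simp) (by simp)
    have h0 : A (p, 0) = 0 := hz 0 (by omega) p hp
    simp only [h0] at this
    simpa [pow_succ, mul_assoc] using this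

/-- An analytic function in a neighborhood of the origin of `E × ℂ` splits off the largest power
of the last variable; the cofactor is continuous, and analytic on `{w = 0}`. -/
lemma AnalyticAt.exists_eq_snd_pow_mul_of_ball {A : E × ℂ → ℂ} {r : ℝ} (hr : 0 < r) {m : ℕ}
    (hA : AnalyticOnNhd ℂ A (Metric.ball 0 r))
    (hz : ∀ k < m, ∀ p ∈ Metric.ball (0 : E) r, sndDeriv^[k] A (p, 0) = 0) :
    ∃ B : E × ℂ → ℂ, (∀ᶠ q in 𝓝 0, ContinuousAt B q) ∧ (∀ᶠ q in 𝓝 0, A q = q.2 ^ m * B q) ∧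
      ∀ p, B (p, 0) = sndDeriv^[m] A (p, 0) / (m.factorial : ℂ) := by
  set c : E → ℂ := fun p => sndDeriv^[m] A (p, 0) / (m.factorial : ℂ) with hc
  have hmem : ∀ p : E, p ∈ Metric.ball (0 : E) r → (p, (0 : ℂ)) ∈ Metric.ball (0 : E × ℂ) r := by
    intro p hp
    simpa [Prod.norm_def] using hp
  have hmem' : ∀ q : E × ℂ, q ∈ Metric.ball (0 : E × ℂ) r → q.1 ∈ Metric.ball (0 : E) r := by
    intro q hq
    simp only [Metric.mem_ball, dist_zero_right, Prod.norm_def, sup_lt_iff] at hq ⊢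
    exact hq.1
  refine ⟨fun q => if q.2 = 0 then c q.1 else A q / q.2 ^ m, ?_, ?_, by simp [hc]⟩
  · filter_upwards [Metric.ball_mem_nhds (0 : E × ℂ) hr] with q hq
    by_cases hw : q.2 = 0
    · obtain ⟨p, w⟩ := q
      obtain rfl : w = 0 := hw
      have hp := hmem' _ hq
      have hcc : ContinuousAt c p := by
        have := (hA.sndDeriv_iterate m _ hq).continuousAt
        exact (this.comp (f := fun p : E => (p, (0 : ℂ))) (by fun_prop)).div_const _
      have hcc' : ContinuousAt (fun q : E × ℂ => c q.1) (p, 0) :=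
        hcc.comp (f := fun q : E × ℂ => q.1) (x := (p, 0)) continuousAt_fst
      have hlo := isLittleO_sub_leading_term m hA hz p hp
      have ht := hlo.tendsto_div_nhds_zero
      have h0 : Tendsto (fun q : E × ℂ => (if q.2 = 0 then c q.1 else A q / q.2 ^ m) - c q.1)
          (𝓝 (p, 0)) (𝓝 0) := by
        refine squeeze_zero_norm (fun q => ?_) (tendsto_norm_zero.comp ht)
        split_ifs with h
        · rw [sub_self, norm_zero]; exact norm_nonneg _
        · refine le_of_eq ?_
          simp only [Function.comp_apply]
          congr 1
          rw [hc]
          field_simp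
      have := h0.add hcc'.tendsto
      simp only [sub_add_cancel, zero_add] at this
      simpa [ContinuousAt] using this
    · have hcont : ContinuousAt (fun q : E × ℂ => A q / q.2 ^ m) q :=
        (hA q hq).continuousAt.div (continuousAt_snd.pow m) (pow_ne_zero _ hw)
      refine hcont.congr ?_
      filter_upwards [continuousAt_snd.eventually_ne hw] with q' hq'
      simp [hq']
  · filter_upwards [Metric.ball_mem_nhds (0 : E × ℂ) hr] with q hq
    by_cases hw : q.2 = 0
    · obtain ⟨p, w⟩ := q
      obtain rfl : w = 0 := hw
      rcases Nat.eq_zero_or_pos m with rfl | hm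
      · simp [hc]
      · simpa [hm.ne'] using hz 0 hm p (hmem' _ hq)
    · simp only [hw, if_false]
      field_simp

lemma AnalyticAt.exists_eq_snd_pow_mul {A : E × ℂ → ℂ} (hA : AnalyticAt ℂ A 0)
    (hne : ¬ ∀ᶠ q in 𝓝 0, A q = 0) :
    ∃ (m : ℕ) (B : E × ℂ → ℂ), (∀ᶠ q in 𝓝 0, ContinuousAt B q) ∧
      (∀ᶠ q in 𝓝 0, A q = q.2 ^ m * B q) ∧ AnalyticAt ℂ (fun p => B (p, 0)) 0 ∧
      ¬ ∀ᶠ p in 𝓝 0, B (p, 0) = 0 := by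
  obtain ⟨r, hr, hAr⟩ := Metric.eventually_nhds_iff_ball.1 hA.eventually_analyticAt
  have hAr : AnalyticOnNhd ℂ A (Metric.ball 0 r) := hAr
  have hmem : ∀ p : E, p ∈ Metric.ball (0 : E) r → (p, (0 : ℂ)) ∈ Metric.ball (0 : E × ℂ) r := by
    intro p hp
    simpa [Prod.norm_def] using hp
  have hex : ∃ m, ∃ p ∈ Metric.ball (0 : E) r, sndDeriv^[m] A (p, 0) ≠ 0 := by
    by_contra! hcon
    refine hne ?_
    filter_upwards [Metric.ball_mem_nhds (0 : E × ℂ) hr] with q hq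
    obtain ⟨p, w⟩ := q
    simp only [Metric.mem_ball, dist_zero_right, Prod.norm_def, sup_lt_iff] at hq
    have hp : p ∈ Metric.ball (0 : E) r := by simpa using hq.1
    have hline : AnalyticOnNhd ℂ (fun t => A (p, t)) (Metric.ball (0 : ℂ) r) := by
      intro t ht
      refine (hAr (p, t) ?_).comp (f := fun t : ℂ => (p, t))
        (analyticAt_const.prod analyticAt_id)
      simpa [Prod.norm_def] using ⟨hq.1, by simpa using ht⟩
    have h0 : (fun t => A (p, t)) =ᶠ[𝓝 0] 0 := by
      by_contra hn
      obtain ⟨n, g, hg, hg0, hgn⟩ :=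
        (hline 0 (by simpa)).exists_eventuallyEq_pow_smul_nonzero_iff.2 hn
      have hlo := isLittleO_sub_leading_term n hAr (fun k _ => hcon k) p hp
      have ht : Tendsto (fun t : ℂ => (p, t)) (𝓝[≠] 0) (𝓝 (p, 0)) :=
        (Continuous.tendsto' (by fun_prop) _ _ rfl).mono_left nhdsWithin_le_nhds
      have h1 := (hlo.comp_tendsto ht).tendsto_div_nhds_zero
      have h2 : Tendsto g (𝓝[≠] 0) (𝓝 0) := by
        refine h1.congr' ?_
        filter_upwards [hgn.filter_mono nhdsWithin_le_nhds, self_mem_nhdsWithin]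
          with t ht ht0
        have ht0 : t ≠ 0 := ht0
        simp only [Function.comp_apply, ht, hcon n p hp]
        simp [ht0]
      exact hg0 (tendsto_nhds_unique (hg.continuousAt.tendsto.mono_left nhdsWithin_le_nhds) h2)
    exact hline.eqOn_zero_of_preconnected_of_eventuallyEq_zero
      (convex_ball _ _).isPreconnected (by simpa) h0 (by simpa using hq.2)
  classical
  set m := Nat.find hex
  have hlt : ∀ k < m, ∀ p ∈ Metric.ball (0 : E) r, sndDeriv^[k] A (p, 0) = 0 := by
    intro k hk
    simpa using Nat.find_min hex hk
  obtain ⟨B, hB1, hB2, hB3⟩ := exists_eq_snd_pow_mul_of_ball hr hAr hlt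
  have hcan : AnalyticOnNhd ℂ (fun p => B (p, 0)) (Metric.ball 0 r) := by
    simp only [hB3]
    intro p hp
    exact ((hAr.sndDeriv_iterate m _ (hmem p hp)).comp (f := fun p : E => (p, (0 : ℂ)))
      (analyticAt_id.prod analyticAt_const)).div_const
  refine ⟨m, B, hB1, hB2, hcan 0 (by simpa), fun h0 => ?_⟩
  obtain ⟨p, hp, hpm⟩ := Nat.find_spec hex
  have := hcan.eqOn_zero_of_preconnected_of_eventuallyEq_zero
      (convex_ball _ _).isPreconnected (by simpa) h0 hp
  simp only [hB3, Pi.zero_apply] at this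
  have hm0 : (m.factorial : ℂ) ≠ 0 := by exact_mod_cast m.factorial_ne_zero
  exact hpm ((div_eq_zero_iff.1 this).resolve_right hm0)

lemma AnalyticAt.exists_eq_snd_mul {A : E × ℂ → ℂ} (hA : AnalyticAt ℂ A 0)
    (h0 : ∀ᶠ p in 𝓝 0, A (p, 0) = 0) :
    ∃ B : E × ℂ → ℂ, (∀ᶠ q in 𝓝 0, ContinuousAt B q) ∧ (∀ᶠ q in 𝓝 0, A q = q.2 * B q) ∧
      B 0 = deriv (fun w => A (0, w)) 0 := by
  obtain ⟨r₁, hr₁, hAr₁⟩ := Metric.eventually_nhds_iff_ball.1 hA.eventually_analyticAt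
  obtain ⟨r₂, hr₂, hz⟩ := Metric.eventually_nhds_iff_ball.1 h0
  obtain ⟨B, hB1, hB2, hB3⟩ := exists_eq_snd_pow_mul_of_ball (m := 1) (lt_min hr₁ hr₂)
    (fun q hq => hAr₁ q (Metric.ball_subset_ball (min_le_left _ _) hq))
    (fun k hk p hp => by
      obtain rfl : k = 0 := by omega
      exact hz p (Metric.ball_subset_ball (min_le_right _ _) hp))
  refine ⟨B, hB1, by simpa using hB2, ?_⟩
  have hA' : AnalyticAt ℂ A ((0 : E), (0 : ℂ)) := hA
  rw [hA'.hasDerivAt_snd.deriv]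
  simpa [← Prod.mk_zero_zero] using hB3 0

end Hadamard

section OneVariable

lemma ContinuousAt.eq_zero_of_eventually_punctured {X : Type*} [TopologicalSpace X] {x : X}
    [(𝓝[≠] x).NeBot] {g : X → ℂ} (hg : ContinuousAt g x) (h : ∀ᶠ t in 𝓝[≠] x, g t = 0) :
    g x = 0 :=
  tendsto_nhds_unique (hg.tendsto.mono_left nhdsWithin_le_nhds)
    (tendsto_const_nhds.congr' (h.mono fun _ ht => ht.symm))

lemma AnalyticAt.exists_continuousAt_slope {u : ℂ → ℂ} (hu : AnalyticAt ℂ u 0) :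
    ∃ V : ℂ × ℂ → ℂ, ContinuousAt V 0 ∧ V 0 = deriv u 0 ∧
      ∀ᶠ q in 𝓝 (0 : ℂ × ℂ), u q.1 - u q.2 = (q.1 - q.2) * V q := by
  have hA : AnalyticAt ℂ (fun q : ℂ × ℂ => u (q.1 + q.2) - u q.1) 0 := by
    have h1 : AnalyticAt ℂ (fun q : ℂ × ℂ => u (q.1 + q.2)) 0 :=
      AnalyticAt.fun_comp (g := u) (f := fun q : ℂ × ℂ => q.1 + q.2) (by simpa using hu)
        (analyticAt_fst.add analyticAt_snd)
    have h2 : AnalyticAt ℂ (fun q : ℂ × ℂ => u q.1) 0 :=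
      AnalyticAt.fun_comp (g := u) (f := fun q : ℂ × ℂ => q.1) hu analyticAt_fst
    exact h1.sub h2
  obtain ⟨B, hB1, hB2, hB3⟩ := hA.exists_eq_snd_mul (by simp)
  have ht : ContinuousAt (fun q : ℂ × ℂ => (q.2, q.1 - q.2)) 0 := by fun_prop
  have ht0 : Tendsto (fun q : ℂ × ℂ => (q.2, q.1 - q.2)) (𝓝 0) (𝓝 0) := by
    simpa [ContinuousAt, Prod.mk_zero_zero] using ht
  refine ⟨fun q => B (q.2, q.1 - q.2), ?_, ?_, ?_⟩
  · exact ContinuousAt.comp' (g := B) (by simpa [Prod.mk_zero_zero] using hB1.self_of_nhds) ht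
  · simpa [Prod.mk_zero_zero] using hB3
  · filter_upwards [ht0.eventually hB2] with q hq
    simpa using hq

/-- A nonconstant analytic germ separates germs of curves with the same nonzero velocity. -/
lemma AnalyticAt.eventuallyEq_of_comp_eq {s x₁ x₂ : ℂ → ℂ} {μ : ℂ} (hs : AnalyticAt ℂ s 0)
    (hs0 : s 0 = 0) (hne : ¬ ∀ᶠ t in 𝓝 0, s t = 0) (hμ : μ ≠ 0)
    (h₁ : Tendsto (fun t => x₁ t / t) (𝓝[≠] 0) (𝓝 μ))
    (h₂ : Tendsto (fun t => x₂ t / t) (𝓝[≠] 0) (𝓝 μ))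
    (h : ∀ᶠ t in 𝓝[≠] 0, s (x₁ t) = s (x₂ t)) : ∀ᶠ t in 𝓝[≠] 0, x₁ t = x₂ t := by
  obtain ⟨k, u, hu, hu0, hsu⟩ := hs.exists_eventuallyEq_pow_smul_nonzero_iff.2 hne
  have hk : k ≠ 0 := by
    rintro rfl
    have := hsu.self_of_nhds
    simp [hs0] at this
    exact hu0 this.symm
  obtain ⟨V, hV, -, hVu⟩ := hu.exists_continuousAt_slope
  have hid : Tendsto (fun t : ℂ => t) (𝓝[≠] 0) (𝓝 0) := tendsto_id.mono_left nhdsWithin_le_nhds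
  have hx : ∀ {x : ℂ → ℂ}, Tendsto (fun t => x t / t) (𝓝[≠] 0) (𝓝 μ) →
      Tendsto x (𝓝[≠] 0) (𝓝 0) := by
    intro x hx
    have := hx.mul hid
    rw [mul_zero] at this
    refine this.congr' ?_
    filter_upwards [self_mem_nhdsWithin] with t ht
    exact div_mul_cancel₀ _ ht
  have hx₁ := hx h₁
  have hx₂ := hx h₂
  have hx₁₂ : Tendsto (fun t => (x₁ t, x₂ t)) (𝓝[≠] 0) (𝓝 (0 : ℂ × ℂ)) := hx₁.prodMk_nhds hx₂
  have hlim : Tendsto (fun t => (∑ i ∈ Finset.range k, (x₁ t / t) ^ i * (x₂ t / t) ^ (k - 1 - i))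
      * u (x₁ t) + (x₂ t / t) ^ k * (t * V (x₁ t, x₂ t))) (𝓝[≠] 0)
      (𝓝 ((∑ i ∈ Finset.range k, μ ^ i * μ ^ (k - 1 - i)) * u 0 + μ ^ k * (0 * V 0))) := by
    refine Tendsto.add (Tendsto.mul ?_ (hu.continuousAt.tendsto.comp hx₁))
      ((h₂.pow k).mul (hid.mul (hV.tendsto.comp hx₁₂)))
    exact tendsto_finsetSum _ fun i _ => (h₁.pow i).mul (h₂.pow _)
  have hsum : ∑ i ∈ Finset.range k, μ ^ i * μ ^ (k - 1 - i) = k * μ ^ (k - 1) := by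
    rw [Finset.sum_congr rfl (g := fun _ => μ ^ (k - 1)), Finset.sum_const, Finset.card_range,
      nsmul_eq_mul]
    intro i hi
    rw [← pow_add]
    congr 1
    have := Finset.mem_range.1 hi
    omega
  have hlim0 : (∑ i ∈ Finset.range k, μ ^ i * μ ^ (k - 1 - i)) * u 0 + μ ^ k * (0 * V 0) ≠ 0 := by
    rw [hsum]
    simpa using ⟨⟨hk, fun h => absurd h hμ⟩, hu0⟩
  filter_upwards [h, hlim.eventually_ne hlim0, hx₁.eventually hsu, hx₂.eventually hsu,
    hx₁₂.eventually hVu, self_mem_nhdsWithin] with t hst hnz hs₁ hs₂ hV' ht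
  have ht : t ≠ 0 := ht
  simp only [sub_zero, smul_eq_mul] at hs₁ hs₂ hV'
  set y₁ := x₁ t / t with hy₁
  set y₂ := x₂ t / t with hy₂
  have e₁ : x₁ t = t * y₁ := by rw [hy₁]; field_simp
  have e₂ : x₂ t = t * y₂ := by rw [hy₂]; field_simp
  have hgeom := (Commute.all y₁ y₂).geom_sum₂_mul k
  set S := ∑ i ∈ Finset.range k, y₁ ^ i * y₂ ^ (k - 1 - i)
  have hpow : y₁ ^ k * u (x₁ t) = y₂ ^ k * u (x₂ t) := by
    refine mul_left_cancel₀ (pow_ne_zero k ht) ?_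
    have : x₁ t ^ k * u (x₁ t) = x₂ t ^ k * u (x₂ t) := by rw [← hs₁, ← hs₂, hst]
    calc t ^ k * (y₁ ^ k * u (x₁ t)) = (t * y₁) ^ k * u (x₁ t) := by ring
      _ = (t * y₂) ^ k * u (x₂ t) := by rw [← e₁, ← e₂, this]
      _ = _ := by ring
  have hprod : (y₁ - y₂) * (S * u (x₁ t) + y₂ ^ k * (t * V (x₁ t, x₂ t))) = 0 := by
    have hx : x₁ t - x₂ t = t * (y₁ - y₂) := by rw [e₁, e₂]; ring
    rw [hx] at hV'
    linear_combination u (x₁ t) * hgeom + hpow - y₂ ^ k * hV'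
  have := (mul_eq_zero.1 hprod).resolve_right hnz
  rw [e₁, e₂, sub_eq_zero.1 this]

end OneVariable

section Conjugation

@[fun_prop]
lemma continuous_cj : Continuous cj := Complex.continuous_conj

@[simp] lemma cj_zero : cj 0 = 0 := map_zero (starRingEnd ℂ)

@[simp] lemma cj_cj (z : ℂ) : cj (cj z) = z := Complex.conj_conj z

lemma cj_mul (z w : ℂ) : cj (z * w) = cj z * cj w := map_mul (starRingEnd ℂ) z w

lemma cj_div (z w : ℂ) : cj (z / w) = cj z / cj w := map_div₀ (starRingEnd ℂ) z w

lemma cj_injective : Function.Injective cj := (starRingEnd ℂ).injective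

lemma tendsto_cj_zero : Tendsto cj (𝓝 0) (𝓝 0) := continuous_cj.tendsto' _ _ cj_zero

lemma tendsto_cj_punctured : Tendsto cj (𝓝[≠] 0) (𝓝[≠] 0) :=
  tendsto_nhdsWithin_iff.2 ⟨tendsto_cj_zero.mono_left nhdsWithin_le_nhds, by
    filter_upwards [self_mem_nhdsWithin] with z hz h
    exact hz (cj_injective (by simpa using h))⟩

end Conjugation

section Mapping

lemma IsNormalCoord.analyticAt {Q : ℂ → ℂ → ℂ → ℂ} (hQ : IsNormalCoord Q) :
    AnalyticAt ℂ (fun q : (ℂ × ℂ) × ℂ => Q q.1.1 q.1.2 q.2) 0 :=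
  AnalyticAt.fun_comp (g := fun p : ℂ × ℂ × ℂ => Q p.1 p.2.1 p.2.2)
    (f := fun q : (ℂ × ℂ) × ℂ => (q.1.1, q.1.2, q.2)) hQ.1
    ((analyticAt_fst.fun_comp analyticAt_fst).prod
      ((analyticAt_snd.fun_comp analyticAt_fst).prod analyticAt_snd))

lemma IsNormalCoord.apply_zero {Q : ℂ → ℂ → ℂ → ℂ} (hQ : IsNormalCoord Q) : Q 0 0 0 = 0 :=
  hQ.2.1.self_of_nhds

variable {Q Q' : ℂ → ℂ → ℂ → ℂ} {F G : ℂ → ℂ → ℂ}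

lemma SendsInto.eventually_eq (h : SendsInto Q Q' F G) :
    ∀ᶠ q : (ℂ × ℂ) × ℂ in 𝓝 0, G q.1.1 (Q q.1.1 q.1.2 q.2) =
      Q' (F q.1.1 (Q q.1.1 q.1.2 q.2)) (cj (F (cj q.1.2) (cj q.2))) (cj (G (cj q.1.2) (cj q.2))) :=
  (Continuous.tendsto' (f := fun q : (ℂ × ℂ) × ℂ => (q.1.1, q.1.2, q.2)) (by fun_prop)
    0 0 rfl).eventually h.2.2.2.2

lemma tendsto_uncurry_zero {F : ℂ → ℂ → ℂ} (hF : AnalyticAt ℂ (fun p : ℂ × ℂ => F p.1 p.2) 0)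
    (hF0 : F 0 0 = 0) : Tendsto (fun p : ℂ × ℂ => F p.1 p.2) (𝓝 0) (𝓝 0) := by
  simpa [ContinuousAt, hF0] using hF.continuousAt

lemma tendsto_mk_zero : Tendsto (fun z : ℂ => (z, (0 : ℂ))) (𝓝 0) (𝓝 0) :=
  Continuous.tendsto' (by fun_prop) _ _ rfl

lemma tendsto_zero_mk : Tendsto (fun z : ℂ => ((0 : ℂ), z)) (𝓝 0) (𝓝 0) :=
  Continuous.tendsto' (by fun_prop) _ _ rfl

lemma SendsInto.eventually_snd_apply_zero (hQ : IsNormalCoord Q) (hQ' : IsNormalCoord Q')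
    (h : SendsInto Q Q' F G) : ∀ᶠ z in 𝓝 0, G z 0 = 0 := by
  have ht : Tendsto (fun z : ℂ => ((z, (0 : ℂ)), (0 : ℂ))) (𝓝 0) (𝓝 0) :=
    Continuous.tendsto' (by fun_prop) _ _ rfl
  have hF : Tendsto (fun z : ℂ => (F z 0, (0 : ℂ))) (𝓝 0) (𝓝 0) :=
    ((tendsto_uncurry_zero h.1 h.2.2.1).comp tendsto_mk_zero).prodMk_nhds tendsto_const_nhds
  filter_upwards [ht.eventually h.eventually_eq, tendsto_mk_zero.eventually hQ.2.1,
    hF.eventually hQ'.2.1] with z h1 h2 h3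
  simpa [h2, h.2.2.1, h.2.2.2.1, h3] using h1

lemma SendsInto.jacobian_ne_zero (hQ : IsNormalCoord Q) (hQ' : IsNormalCoord Q')
    (h : SendsInto Q Q' F G) (hb : JacDet F G ≠ 0) : pd F 1 0 0 0 ≠ 0 ∧ pd G 0 1 0 0 ≠ 0 := by
  have h0 : pd G 1 0 0 0 = 0 := by
    have : (fun z => G z 0) =ᶠ[𝓝 0] fun _ => 0 := h.eventually_snd_apply_zero hQ hQ'
    simpa [pd] using this.deriv_eq
  rw [JacDet, h0, mul_zero, sub_zero] at hb
  exact mul_ne_zero_iff.1 hb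

/-- The transversal component of a map into `M'` is divisible by `w`. -/
lemma SendsInto.exists_snd_eq_mul (hQ : IsNormalCoord Q) (hQ' : IsNormalCoord Q')
    (h : SendsInto Q Q' F G) :
    ∃ K : ℂ × ℂ → ℂ, (∀ᶠ q in 𝓝 0, ContinuousAt K q) ∧
      (∀ᶠ q : ℂ × ℂ in 𝓝 0, G q.1 q.2 = q.2 * K q) ∧ K 0 = pd G 0 1 0 0 :=
  h.2.1.exists_eq_snd_mul (h.eventually_snd_apply_zero hQ hQ')

lemma tendsto_div_segre (hF : AnalyticAt ℂ (fun p : ℂ × ℂ => F p.1 p.2) 0) (hF0 : F 0 0 = 0) :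
    Tendsto (fun z => F z 0 / z) (𝓝[≠] 0) (𝓝 (pd F 1 0 0 0)) := by
  have : DifferentiableAt ℂ (fun z => F z 0) 0 :=
    hF.differentiableAt.comp (f := fun z : ℂ => (z, (0 : ℂ))) (0 : ℂ) (by fun_prop)
  have := this.hasDerivAt.tendsto_slope
  simpa [slope_fun_def_field, hF0, pd] using this

lemma tendsto_div_conj_segre (hF : AnalyticAt ℂ (fun p : ℂ × ℂ => F p.1 p.2) 0)
    (hF0 : F 0 0 = 0) :
    Tendsto (fun χ => cj (F (cj χ) 0) / χ) (𝓝[≠] 0) (𝓝 (cj (pd F 1 0 0 0))) := by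
  have := (continuous_cj.tendsto _).comp ((tendsto_div_segre hF hF0).comp tendsto_cj_punctured)
  simpa [Function.comp_def, cj_div] using this

/-- If `Q'(x, y, 0) = x ^ a B(y, x)`, then the map transforms the leading term in `z` of
`Q(z, χ, 0)` into `B(y, 0)`. -/
lemma SendsInto.tendsto_finiteType (hQ : IsNormalCoord Q) (hQ' : IsNormalCoord Q')
    (h : SendsInto Q Q' F G) (hb : JacDet F G ≠ 0) {a : ℕ} {B P : ℂ × ℂ → ℂ}
    (hBc : ∀ᶠ q in 𝓝 0, ContinuousAt B q)
    (hB : ∀ᶠ q : ℂ × ℂ in 𝓝 0, Q' q.2 q.1 0 = q.2 ^ a * B q)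
    (hPc : ∀ᶠ q in 𝓝 0, ContinuousAt P q)
    (hP : ∀ᶠ q : ℂ × ℂ in 𝓝 0, Q q.2 q.1 0 = q.2 * P q) :
    ∀ᶠ χ in 𝓝 0, Tendsto (fun z => Q z χ 0 / z ^ a) (𝓝[≠] 0)
      (𝓝 ((pd F 1 0 0 0 + P (χ, 0) * pd F 0 1 0 0) ^ a * B (cj (F (cj χ) 0), 0)
        / pd G 0 1 0 0)) := by
  obtain ⟨K, hKc, hK, hK0⟩ := h.exists_snd_eq_mul hQ hQ'
  have hγ := (h.jacobian_ne_zero hQ hQ' hb).2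
  have hFan : AnalyticAt ℂ (fun p : ℂ × ℂ => F p.1 p.2 - F p.1 0) 0 :=
    h.1.sub (AnalyticAt.fun_comp (g := fun p : ℂ × ℂ => F p.1 p.2) (f := fun q : ℂ × ℂ => (q.1, 0))
      h.1 (analyticAt_fst.prod analyticAt_const))
  obtain ⟨L, hLc, hL, hL0⟩ := hFan.exists_eq_snd_mul (by simp)
  have hL0 : L 0 = pd F 0 1 0 0 := by simpa [pd] using hL0
  have hFb : Tendsto (fun χ => cj (F (cj χ) 0)) (𝓝 0) (𝓝 0) :=
    tendsto_cj_zero.comp ((tendsto_uncurry_zero h.1 h.2.2.1).comp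
      (tendsto_mk_zero.comp tendsto_cj_zero))
  have hQ0 : Tendsto (fun q : ℂ × ℂ => Q q.2 q.1 0) (𝓝 0) (𝓝 0) := by
    have := hQ.analyticAt.continuousAt.tendsto.comp (Continuous.tendsto'
      (f := fun q : ℂ × ℂ => ((q.2, q.1), (0 : ℂ))) (by fun_prop) 0 0 rfl)
    simpa [Function.comp_def, hQ.apply_zero] using this
  have hzQ : Tendsto (fun q : ℂ × ℂ => (q.2, Q q.2 q.1 0)) (𝓝 0) (𝓝 0) :=
    (continuous_snd.tendsto' (0 : ℂ × ℂ) 0 rfl).prodMk_nhds hQ0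
  have hFQ : Tendsto (fun q : ℂ × ℂ => (cj (F (cj q.1) 0), F q.2 (Q q.2 q.1 0))) (𝓝 0) (𝓝 0) :=
    (hFb.comp (continuous_fst.tendsto' (0 : ℂ × ℂ) 0 rfl)).prodMk_nhds
      ((tendsto_uncurry_zero h.1 h.2.2.1).comp hzQ)
  have hid : ∀ᶠ q : ℂ × ℂ in 𝓝 0, Q q.2 q.1 0 * K (q.2, Q q.2 q.1 0) =
      F q.2 (Q q.2 q.1 0) ^ a * B (cj (F (cj q.1) 0), F q.2 (Q q.2 q.1 0)) := by
    have ht : Tendsto (fun q : ℂ × ℂ => ((q.2, q.1), (0 : ℂ))) (𝓝 0) (𝓝 0) :=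
      Continuous.tendsto' (by fun_prop) _ _ rfl
    have ht' : Tendsto (fun q : ℂ × ℂ => cj q.1) (𝓝 0) (𝓝 0) :=
      Continuous.tendsto' (by fun_prop) _ _ (by simp)
    filter_upwards [ht.eventually h.eventually_eq, hzQ.eventually hK, hFQ.eventually hB,
      ht'.eventually (h.eventually_snd_apply_zero hQ hQ')] with q h1 h2 h3 h4
    simp only [cj_zero, h4] at h1
    rw [← h2, ← h3, h1]
  have hLQ : ∀ᶠ q : ℂ × ℂ in 𝓝 0, F q.2 (Q q.2 q.1 0) - F q.2 0 =
      Q q.2 q.1 0 * L (q.2, Q q.2 q.1 0) := hzQ.eventually hL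
  filter_upwards [Eventually.curry_nhds (x := (0 : ℂ)) (y := (0 : ℂ)) hid,
    Eventually.curry_nhds (x := (0 : ℂ)) (y := (0 : ℂ)) hLQ,
    Eventually.curry_nhds (x := (0 : ℂ)) (y := (0 : ℂ)) hP, tendsto_mk_zero.eventually hPc,
    (tendsto_mk_zero.comp hFb).eventually hBc] with χ hid hLQ hP hPc hBc
  have hz : Tendsto (fun z : ℂ => z) (𝓝[≠] 0) (𝓝 0) := tendsto_id.mono_left nhdsWithin_le_nhds
  have hP' : Tendsto (fun z => P (χ, z)) (𝓝[≠] 0) (𝓝 (P (χ, 0))) :=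
    hPc.tendsto.comp ((Continuous.tendsto' (by fun_prop) _ _ rfl).mono_left nhdsWithin_le_nhds)
  have hne : ∀ᶠ z : ℂ in 𝓝[≠] 0, z ≠ 0 := self_mem_nhdsWithin
  have hQz : Tendsto (fun z => Q z χ 0) (𝓝[≠] 0) (𝓝 0) := by
    have := hz.mul hP'
    rw [zero_mul] at this
    exact this.congr' ((hP.filter_mono nhdsWithin_le_nhds).mono fun z hz => hz.symm)
  have hzQz : Tendsto (fun z => (z, Q z χ 0)) (𝓝[≠] 0) (𝓝 (0 : ℂ × ℂ)) := hz.prodMk_nhds hQz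
  have hKz : Tendsto (fun z => K (z, Q z χ 0)) (𝓝[≠] 0) (𝓝 (pd G 0 1 0 0)) := by
    rw [← hK0]; exact hKc.self_of_nhds.tendsto.comp hzQz
  have hLz : Tendsto (fun z => L (z, Q z χ 0)) (𝓝[≠] 0) (𝓝 (pd F 0 1 0 0)) := by
    rw [← hL0]; exact hLc.self_of_nhds.tendsto.comp hzQz
  have hFz : Tendsto (fun z => F z (Q z χ 0)) (𝓝[≠] 0) (𝓝 0) :=
    (tendsto_uncurry_zero h.1 h.2.2.1).comp hzQz
  have hBz : Tendsto (fun z => B (cj (F (cj χ) 0), F z (Q z χ 0))) (𝓝[≠] 0)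
      (𝓝 (B (cj (F (cj χ) 0), 0))) :=
    hBc.tendsto.comp (tendsto_const_nhds.prodMk_nhds hFz)
  have hFdiv : Tendsto (fun z => F z (Q z χ 0) / z) (𝓝[≠] 0)
      (𝓝 (pd F 1 0 0 0 + P (χ, 0) * pd F 0 1 0 0)) := by
    refine ((tendsto_div_segre h.1 h.2.2.1).add (hP'.mul hLz)).congr' ?_
    filter_upwards [hLQ.filter_mono nhdsWithin_le_nhds, hP.filter_mono nhdsWithin_le_nhds, hne]
      with z h1 h2 h3
    field_simp
    linear_combination -h1 + L (z, Q z χ 0) * (-h2)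
  refine (((hFdiv.pow a).mul hBz).div hKz hγ).congr' ?_
  filter_upwards [hid.filter_mono nhdsWithin_le_nhds, hne, hKz.eventually_ne hγ] with z h1 h2 h3
  simp only [Pi.div_apply, div_pow]
  field_simp
  linear_combination -h1

lemma eventually_continuousAt_comp {X Y Z : Type*} [TopologicalSpace X] [TopologicalSpace Y]
    [TopologicalSpace Z] {f : X → Y} {g : Y → Z} {x₀ : X} {y₀ : Y}
    (hg : ∀ᶠ y in 𝓝 y₀, ContinuousAt g y) (hf : ∀ᶠ x in 𝓝 x₀, ContinuousAt f x)
    (hf₀ : Tendsto f (𝓝 x₀) (𝓝 y₀)) : ∀ᶠ x in 𝓝 x₀, ContinuousAt (fun x => g (f x)) x := by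
  filter_upwards [hf, hf₀.eventually hg] with x h₁ h₂
  exact ContinuousAt.comp' h₂ h₁

/-- The leading coefficient in `w` of `Q'(x, y, w) - w` vanishes on the coordinate axes. -/
lemma IsNormalCoord.leading_coeff_axes (hQ' : IsNormalCoord Q') {m : ℕ}
    {B : (ℂ × ℂ) × ℂ → ℂ} (hBc : ∀ᶠ q in 𝓝 0, ContinuousAt B q)
    (hB : ∀ᶠ q : (ℂ × ℂ) × ℂ in 𝓝 0, Q' q.1.1 q.1.2 q.2 - q.2 = q.2 ^ m * B q) :
    (∀ᶠ x in 𝓝 0, B ((x, 0), 0) = 0) ∧ ∀ᶠ y in 𝓝 0, B ((0, y), 0) = 0 := by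
  have key : ∀ i : ℂ → ℂ × ℂ, Continuous i → i 0 = 0 →
      (∀ᶠ p : ℂ × ℂ in 𝓝 0, Q' (i p.1).1 (i p.1).2 p.2 = p.2) →
      ∀ᶠ x in 𝓝 0, B (i x, 0) = 0 := by
    intro i hi hi0 hQi
    have ht : Tendsto (fun p : ℂ × ℂ => (i p.1, p.2)) (𝓝 0) (𝓝 0) :=
      Continuous.tendsto' (by fun_prop) _ _ (by simp [hi0])
    have ht' : Tendsto (fun x => (i x, (0 : ℂ))) (𝓝 0) (𝓝 0) :=
      Continuous.tendsto' (by fun_prop) _ _ (by simp [hi0])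
    filter_upwards [Eventually.curry_nhds (x := (0 : ℂ)) (y := (0 : ℂ))
      ((ht.eventually hB).and hQi), ht'.eventually hBc] with x hx hc
    refine ContinuousAt.eq_zero_of_eventually_punctured (g := fun w => B (i x, w)) (x := (0 : ℂ))
      (ContinuousAt.comp' (g := B) hc (by fun_prop)) ?_
    filter_upwards [hx.filter_mono nhdsWithin_le_nhds, self_mem_nhdsWithin] with w hw hw0
    have h1 := hw.1
    simp only [hw.2, sub_self] at h1
    exact (mul_eq_zero.1 h1.symm).resolve_left (pow_ne_zero _ hw0)
  exact ⟨key (fun x => (x, 0)) (by fun_prop) rfl hQ'.2.1,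
    key (fun y => (0, y)) (by fun_prop) rfl hQ'.2.2.1⟩

/-- Joint limit behind the infinite type case: the quotient of the two sides of the mapping
identity by `τ ^ m`. -/
lemma SendsInto.tendsto_sub_conj_div (hQ : IsNormalCoord Q) (hQ' : IsNormalCoord Q')
    (h : SendsInto Q Q' F G) {m : ℕ} {B : (ℂ × ℂ) × ℂ → ℂ} {K : ℂ × ℂ → ℂ}
    (hBc : ∀ᶠ q in 𝓝 0, ContinuousAt B q)
    (hB : ∀ᶠ q : (ℂ × ℂ) × ℂ in 𝓝 0, Q' q.1.1 q.1.2 q.2 - q.2 = q.2 ^ m * B q)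
    (hKc : ∀ᶠ q in 𝓝 0, ContinuousAt K q) (hK : ∀ᶠ q : ℂ × ℂ in 𝓝 0, G q.1 q.2 = q.2 * K q)
    (hQ0 : ∀ᶠ p : ℂ × ℂ in 𝓝 0, Q p.1 p.2 0 = 0) :
    ∀ᶠ p : ℂ × ℂ in 𝓝 0,
      Tendsto (fun τ => (G p.1 (Q p.1 p.2 τ) - cj (G (cj p.2) (cj τ))) / τ ^ m) (𝓝[≠] 0)
        (𝓝 (cj (K (cj p.2, 0)) ^ m * B ((F p.1 0, cj (F (cj p.2) 0)), 0))) ∧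
      Tendsto (fun τ => cj (G (cj p.2) (cj τ)) / τ) (𝓝[≠] 0) (𝓝 (cj (K (cj p.2, 0)))) := by
  have hQt : Tendsto (fun q : (ℂ × ℂ) × ℂ => (q.1.1, Q q.1.1 q.1.2 q.2)) (𝓝 0) (𝓝 0) := by
    refine (Continuous.tendsto' (by fun_prop) (0 : (ℂ × ℂ) × ℂ) 0 rfl).prodMk_nhds ?_
    simpa [ContinuousAt, hQ.apply_zero] using hQ.analyticAt.continuousAt
  have hQc : ∀ᶠ q : (ℂ × ℂ) × ℂ in 𝓝 0,
      ContinuousAt (fun q : (ℂ × ℂ) × ℂ => (q.1.1, Q q.1.1 q.1.2 q.2)) q :=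
    hQ.analyticAt.eventually_analyticAt.mono fun q hq =>
      (by fun_prop : Continuous fun q : (ℂ × ℂ) × ℂ => q.1.1).continuousAt.prodMk hq.continuousAt
  have hbar : Continuous fun q : (ℂ × ℂ) × ℂ => (cj q.1.2, cj q.2) := by fun_prop
  have hbart : Tendsto (fun q : (ℂ × ℂ) × ℂ => (cj q.1.2, cj q.2)) (𝓝 0) (𝓝 0) :=
    hbar.tendsto' _ _ (by simp)
  have hconj : ∀ {f : ℂ × ℂ → ℂ}, (∀ᶠ p in 𝓝 0, ContinuousAt f p) →
      ∀ᶠ q : (ℂ × ℂ) × ℂ in 𝓝 0, ContinuousAt (fun q => cj (f (cj q.1.2, cj q.2))) q :=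
    fun {f} hf => (eventually_continuousAt_comp (g := f) hf
      (Eventually.of_forall fun q => hbar.continuousAt) hbart).mono
      fun q hq => ContinuousAt.comp' continuous_cj.continuousAt hq
  have hFc := h.1.eventually_analyticAt.mono fun q hq => hq.continuousAt
  have hGc := h.2.1.eventually_analyticAt.mono fun q hq => hq.continuousAt
  have hFt := tendsto_uncurry_zero h.1 h.2.2.1
  have hGt := tendsto_uncurry_zero h.2.1 h.2.2.2.1
  have hΦt : Tendsto (fun q : (ℂ × ℂ) × ℂ => ((F q.1.1 (Q q.1.1 q.1.2 q.2),
      cj (F (cj q.1.2) (cj q.2))), cj (G (cj q.1.2) (cj q.2)))) (𝓝 0) (𝓝 0) :=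
    ((hFt.comp hQt).prodMk_nhds (tendsto_cj_zero.comp (hFt.comp hbart))).prodMk_nhds
      (tendsto_cj_zero.comp (hGt.comp hbart))
  have hΦc : ∀ᶠ q : (ℂ × ℂ) × ℂ in 𝓝 0, ContinuousAt (fun q : (ℂ × ℂ) × ℂ =>
      ((F q.1.1 (Q q.1.1 q.1.2 q.2), cj (F (cj q.1.2) (cj q.2))), cj (G (cj q.1.2) (cj q.2)))) q := by
    filter_upwards [eventually_continuousAt_comp hFc hQc hQt, hconj hFc, hconj hGc] with q h1 h2 h3
    exact (h1.prodMk h2).prodMk h3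
  have hRc := eventually_continuousAt_comp hBc hΦc hΦt
  have hp : Tendsto (fun p : ℂ × ℂ => (p, (0 : ℂ))) (𝓝 0) (𝓝 0) :=
    Continuous.tendsto' (by fun_prop) _ _ rfl
  have hχ : Tendsto (fun p : ℂ × ℂ => cj p.2) (𝓝 0) (𝓝 0) :=
    Continuous.tendsto' (by fun_prop) _ _ (by simp)
  filter_upwards [hp.eventually hRc, hp.eventually (hconj hKc), hQ0,
    hχ.eventually (h.eventually_snd_apply_zero hQ hQ'),
    Eventually.curry_nhds (x := (0 : ℂ × ℂ)) (y := (0 : ℂ)) ((h.eventually_eq.and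
      (hΦt.eventually hB)).and (hbart.eventually hK))] with p hR hb hQp hGp hid
  have hline : Tendsto (fun τ : ℂ => (p, τ)) (𝓝[≠] 0) (𝓝 (p, 0)) :=
    (Continuous.tendsto' (by fun_prop) _ _ rfl).mono_left nhdsWithin_le_nhds
  have hb' := hb.tendsto.comp hline
  have hR' := hR.tendsto.comp hline
  simp only [cj_zero, hQp, hGp] at hb' hR'
  constructor
  · refine ((hb'.pow m).mul hR').congr' ?_
    filter_upwards [hid.filter_mono nhdsWithin_le_nhds, self_mem_nhdsWithin] with τ h1 hτ
    have hτ : τ ≠ 0 := hτ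
    obtain ⟨⟨h1, h2⟩, h3⟩ := h1
    simp only [Function.comp_apply]
    rw [h1, h2, h3, cj_mul, cj_cj, mul_pow]
    field_simp
  · refine hb'.congr' ?_
    filter_upwards [hid.filter_mono nhdsWithin_le_nhds, self_mem_nhdsWithin] with τ h1 hτ
    have hτ : τ ≠ 0 := hτ
    have h3 := h1.2
    simp only [Function.comp_apply]
    rw [h3, cj_mul, cj_cj]
    field_simp

/-- If `Q'(x, y, w) = w + w ^ m B(x, y, w)` with `m ≠ 0`, then the map transforms the coefficient of
`τ ^ m` in `Q(z, χ, τ) - τ` into `B(x, y, 0)`. -/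
lemma SendsInto.tendsto_infiniteType (hQ : IsNormalCoord Q) (hQ' : IsNormalCoord Q')
    (h : SendsInto Q Q' F G) (hb : JacDet F G ≠ 0) {m : ℕ} (hm : m ≠ 0) {B : (ℂ × ℂ) × ℂ → ℂ}
    (hBc : ∀ᶠ q in 𝓝 0, ContinuousAt B q)
    (hB : ∀ᶠ q : (ℂ × ℂ) × ℂ in 𝓝 0, Q' q.1.1 q.1.2 q.2 - q.2 = q.2 ^ m * B q) :
    ∀ᶠ p : ℂ × ℂ in 𝓝 0, Tendsto (fun τ => (Q p.1 p.2 τ - τ) / τ ^ m) (𝓝[≠] 0)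
      (𝓝 (pd G 0 1 0 0 ^ m * B ((F p.1 0, cj (F (cj p.2) 0)), 0) / pd G 0 1 0 0)) := by
  obtain ⟨K, hKc, hK, hK0⟩ := h.exists_snd_eq_mul hQ hQ'
  have hγ := (h.jacobian_ne_zero hQ hQ' hb).2
  obtain ⟨hBx, hBy⟩ := hQ'.leading_coeff_axes hBc hB
  have hfst : Tendsto (fun p : ℂ × ℂ => p.1) (𝓝 0) (𝓝 0) := Continuous.tendsto' (by fun_prop) _ _ rfl
  have hsnd : Tendsto (fun p : ℂ × ℂ => p.2) (𝓝 0) (𝓝 0) := Continuous.tendsto' (by fun_prop) _ _ rfl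
  have hFz : Tendsto (fun p : ℂ × ℂ => F p.1 0) (𝓝 0) (𝓝 0) :=
    (tendsto_uncurry_zero h.1 h.2.2.1).comp (tendsto_mk_zero.comp hfst)
  have hFχ : Tendsto (fun p : ℂ × ℂ => cj (F (cj p.2) 0)) (𝓝 0) (𝓝 0) :=
    tendsto_cj_zero.comp ((tendsto_uncurry_zero h.1 h.2.2.1).comp
      (tendsto_mk_zero.comp (tendsto_cj_zero.comp hsnd)))
  have hp : Tendsto (fun p : ℂ × ℂ => (p, (0 : ℂ))) (𝓝 0) (𝓝 0) :=
    Continuous.tendsto' (by fun_prop) _ _ rfl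
  have hQ0 : ∀ᶠ p : ℂ × ℂ in 𝓝 0, Q p.1 p.2 0 = 0 := by
    have hzQ : Tendsto (fun p : ℂ × ℂ => (p.1, Q p.1 p.2 0)) (𝓝 0) (𝓝 0) := by
      refine hfst.prodMk_nhds ?_
      have := hQ.analyticAt.continuousAt.tendsto.comp hp
      simpa [Function.comp_def, hQ.apply_zero] using this
    have hKne : ∀ᶠ q in 𝓝 0, K q ≠ 0 := hKc.self_of_nhds.eventually_ne (by rwa [hK0])
    have harg : Tendsto (fun p : ℂ × ℂ =>
        ((F p.1 (Q p.1 p.2 0), cj (F (cj p.2) 0)), (0 : ℂ))) (𝓝 0) (𝓝 0) :=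
      (((tendsto_uncurry_zero h.1 h.2.2.1).comp hzQ).prodMk_nhds hFχ).prodMk_nhds tendsto_const_nhds
    filter_upwards [hp.eventually h.eventually_eq, hzQ.eventually hK, hzQ.eventually hKne,
      harg.eventually hB, (tendsto_cj_zero.comp hsnd).eventually
      (h.eventually_snd_apply_zero hQ hQ')] with p h1 h2 h3 h4 h5
    simp only [Function.comp_apply] at h5
    simp only [cj_zero, h5] at h1
    simp only [zero_pow hm, zero_mul, sub_zero] at h4
    rw [h4, h2] at h1
    exact (mul_eq_zero.1 h1).resolve_right h3
  obtain ⟨P, hPc, hP, -⟩ := hQ.analyticAt.exists_eq_snd_mul hQ0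
  have hG0 : AnalyticAt ℂ (G 0) 0 :=
    AnalyticAt.fun_comp (g := fun p : ℂ × ℂ => G p.1 p.2) (f := fun w : ℂ => ((0 : ℂ), w)) h.2.1
      (analyticAt_const.prod analyticAt_id)
  obtain ⟨V, hVc, hV0, hV⟩ := hG0.exists_continuousAt_slope
  have hlim := h.tendsto_sub_conj_div hQ hQ' hBc hB hKc hK hQ0
  have hz0 : Tendsto (fun p : ℂ × ℂ => (p.1, (0 : ℂ))) (𝓝 0) (𝓝 0) := tendsto_mk_zero.comp hfst
  have h0χ : Tendsto (fun p : ℂ × ℂ => ((0 : ℂ), p.2)) (𝓝 0) (𝓝 0) := tendsto_zero_mk.comp hsnd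
  filter_upwards [hlim, hz0.eventually hlim, h0χ.eventually hlim, hp.eventually hPc, hQ0,
    hFz.eventually hBx, hFχ.eventually hBy, hfst.eventually (h.eventually_snd_apply_zero hQ hQ'),
    Eventually.curry_nhds (x := (0 : ℂ × ℂ)) (y := (0 : ℂ)) hP,
    hfst.eventually (Eventually.curry_nhds (x := (0 : ℂ)) (y := (0 : ℂ)) hQ.2.1),
    hsnd.eventually (Eventually.curry_nhds (x := (0 : ℂ)) (y := (0 : ℂ)) hQ.2.2.1)]
    with p hl hlz hlχ hPc hQp hBz hBχ hGz hP hQz hQχ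
  have hl0 := hlim.self_of_nhds.1
  have hB0 := hBx.self_of_nhds
  have hN : 𝓝[≠] (0 : ℂ) ≤ 𝓝 0 := nhdsWithin_le_nhds
  have hid : Tendsto (fun τ : ℂ => τ) (𝓝[≠] 0) (𝓝 0) := tendsto_id.mono_left hN
  have hne : ∀ᶠ τ : ℂ in 𝓝[≠] 0, τ ≠ 0 := self_mem_nhdsWithin
  have hQ00 := (Eventually.curry_nhds (x := (0 : ℂ)) (y := (0 : ℂ)) hQ.2.1).self_of_nhds
  have hlz := hlz.1
  have hlχ := hlχ.1
  simp only [Prod.fst_zero, Prod.snd_zero, cj_zero, h.2.2.1, hBz, hBχ, hB0, mul_zero]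
    at hlz hlχ hl0
  -- `G` is constant in `z` up to order `m` in `w`
  have hE : ContinuousAt (fun w => (G p.1 w - G 0 w) / w ^ m) 0 := by
    rw [← continuousWithinAt_compl_self]
    have := hlz.sub hl0
    simp only [sub_zero] at this
    simp only [ContinuousWithinAt, zero_pow hm, div_zero]
    refine this.congr' ?_
    filter_upwards [hQz.filter_mono hN, hQ00.filter_mono hN] with τ h1 h2
    rw [h1, h2]
    ring
  have hE : Tendsto (fun w => (G p.1 w - G 0 w) / w ^ m) (𝓝 0) (𝓝 0) := by
    simpa [ContinuousAt, zero_pow hm] using hE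
  have hχE : Tendsto (fun τ => (G 0 τ - cj (G (cj p.2) (cj τ))) / τ ^ m) (𝓝[≠] 0) (𝓝 0) := by
    refine hlχ.congr' ?_
    filter_upwards [hQχ.filter_mono hN] with τ h1
    rw [h1]
  have hG0div : Tendsto (fun τ => G 0 τ / τ) (𝓝[≠] 0) (𝓝 (pd G 0 1 0 0)) := by
    have := hG0.differentiableAt.hasDerivAt.tendsto_slope
    simpa [slope_fun_def_field, h.2.2.2.1, pd] using this
  have hKχ : cj (K (cj p.2, 0)) = pd G 0 1 0 0 := by
    have h1 := hχE.mul (hid.pow (m - 1))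
    rw [zero_mul] at h1
    have h2 := hG0div.sub hl.2
    refine (sub_eq_zero.1 (tendsto_nhds_unique h2 (h1.congr' ?_))).symm
    filter_upwards [hne] with τ hτ
    obtain ⟨n, rfl⟩ := Nat.exists_eq_succ_of_ne_zero hm
    simp only [Nat.succ_eq_add_one, Nat.add_sub_cancel, pow_succ]
    field_simp
  have hPz : Tendsto (fun τ => P (p, τ)) (𝓝[≠] 0) (𝓝 (P (p, 0))) :=
    hPc.tendsto.comp ((Continuous.tendsto' (by fun_prop) _ _ rfl).mono_left hN)
  have hQt : Tendsto (fun τ => Q p.1 p.2 τ) (𝓝[≠] 0) (𝓝 0) := by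
    have := hid.mul hPz
    rw [zero_mul] at this
    exact this.congr' ((hP.filter_mono hN).mono fun z hz => hz.symm)
  have hQE := (hE.comp hQt).mul (hPz.pow m)
  rw [zero_mul] at hQE
  have hQt2 : Tendsto (fun τ => (Q p.1 p.2 τ, τ)) (𝓝[≠] 0) (𝓝 (0 : ℂ × ℂ)) := hQt.prodMk_nhds hid
  have hVt : Tendsto (fun τ => V (Q p.1 p.2 τ, τ)) (𝓝[≠] 0) (𝓝 (pd G 0 1 0 0)) := by
    have : V 0 = pd G 0 1 0 0 := by simpa [pd] using hV0
    rw [← this]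
    exact hVc.tendsto.comp hQt2
  have hfin := ((hl.1.sub hQE).sub hχE).div hVt hγ
  rw [hKχ, sub_zero, sub_zero] at hfin
  refine hfin.congr' ?_
  filter_upwards [hne, hP.filter_mono hN, hQt2.eventually hV, hVt.eventually_ne hγ] with τ hτ h1 h2 h3
  have hGE : (G p.1 (Q p.1 p.2 τ) - G 0 (Q p.1 p.2 τ)) / Q p.1 p.2 τ ^ m * P (p, τ) ^ m
      = (G p.1 (Q p.1 p.2 τ) - G 0 (Q p.1 p.2 τ)) / τ ^ m := by
    by_cases hPτ : P (p, τ) = 0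
    · have : Q p.1 p.2 τ = 0 := by rw [h1, hPτ, mul_zero]
      simp [this, hGz, h.2.2.2.1]
    · rw [h1, mul_pow]
      field_simp
  simp only [Pi.div_apply, Function.comp_apply, hGE]
  field_simp
  linear_combination h2

section Comparison

variable {F₁ G₁ F₂ G₂ : ℂ → ℂ → ℂ}

/-- Infinite type case: the leading coefficient in `x` of `B(x, y, 0)` takes the same values along
two maps with the same derivatives at the origin. -/
lemma SendsInto.leading_eq_of_infiniteType (hQ : IsNormalCoord Q) (hQ' : IsNormalCoord Q')
    (h₁ : SendsInto Q Q' F₁ G₁) (h₂ : SendsInto Q Q' F₂ G₂)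
    (hb₁ : JacDet F₁ G₁ ≠ 0) (hb₂ : JacDet F₂ G₂ ≠ 0)
    (hFz : pd F₁ 1 0 0 0 = pd F₂ 1 0 0 0) (hGw : pd G₁ 0 1 0 0 = pd G₂ 0 1 0 0)
    {m a : ℕ} (hm : m ≠ 0) {B : (ℂ × ℂ) × ℂ → ℂ} {S : ℂ × ℂ → ℂ}
    (hBc : ∀ᶠ q in 𝓝 0, ContinuousAt B q)
    (hB : ∀ᶠ q : (ℂ × ℂ) × ℂ in 𝓝 0, Q' q.1.1 q.1.2 q.2 - q.2 = q.2 ^ m * B q)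
    (hSc : ∀ᶠ q in 𝓝 0, ContinuousAt S q)
    (hS : ∀ᶠ q : ℂ × ℂ in 𝓝 0, B ((q.2, q.1), 0) = q.2 ^ a * S q) :
    ∀ᶠ χ in 𝓝 0, S (cj (F₁ (cj χ) 0), 0) = S (cj (F₂ (cj χ) 0), 0) := by
  obtain ⟨hl, hγ⟩ := h₂.jacobian_ne_zero hQ hQ' hb₂
  have hC : ∀ᶠ p : ℂ × ℂ in 𝓝 0, B ((F₁ p.1 0, cj (F₁ (cj p.2) 0)), 0) =
      B ((F₂ p.1 0, cj (F₂ (cj p.2) 0)), 0) := by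
    filter_upwards [h₁.tendsto_infiniteType hQ hQ' hb₁ hm hBc hB,
      h₂.tendsto_infiniteType hQ hQ' hb₂ hm hBc hB] with p h1 h2
    have := tendsto_nhds_unique h1 h2
    rw [hGw] at this
    field_simp at this
    exact this
  have hlim : ∀ {F G : ℂ → ℂ → ℂ}, SendsInto Q Q' F G → ∀ᶠ χ in 𝓝 0,
      Tendsto (fun z => B ((F z 0, cj (F (cj χ) 0)), 0) / z ^ a) (𝓝[≠] 0)
        (𝓝 (pd F 1 0 0 0 ^ a * S (cj (F (cj χ) 0), 0))) := by
    intro F G h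
    have hz : Tendsto (fun z => F z 0) (𝓝 0) (𝓝 0) :=
      (tendsto_uncurry_zero h.1 h.2.2.1).comp tendsto_mk_zero
    have hχ : Tendsto (fun χ => cj (F (cj χ) 0)) (𝓝 0) (𝓝 0) :=
      tendsto_cj_zero.comp (hz.comp tendsto_cj_zero)
    have hq : Tendsto (fun q : ℂ × ℂ => (cj (F (cj q.1) 0), F q.2 0)) (𝓝 0) (𝓝 0) :=
      (hχ.comp (Continuous.tendsto' continuous_fst _ _ rfl)).prodMk_nhds
        (hz.comp (Continuous.tendsto' continuous_snd _ _ rfl))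
    filter_upwards [(tendsto_mk_zero.comp hχ).eventually hSc,
      Eventually.curry_nhds (x := (0 : ℂ)) (y := (0 : ℂ)) (hq.eventually hS)] with χ hc hS
    have hSt : Tendsto (fun z => S (cj (F (cj χ) 0), F z 0)) (𝓝[≠] 0)
        (𝓝 (S (cj (F (cj χ) 0), 0))) :=
      hc.tendsto.comp (tendsto_const_nhds.prodMk_nhds (hz.mono_left nhdsWithin_le_nhds))
    refine (((tendsto_div_segre h.1 h.2.2.1).pow a).mul hSt).congr' ?_
    filter_upwards [hS.filter_mono nhdsWithin_le_nhds] with z h1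
    rw [h1, div_pow]
    ring
  have hswap : Tendsto (fun q : ℂ × ℂ => (q.2, q.1)) (𝓝 0) (𝓝 0) :=
    Continuous.tendsto' (by fun_prop) _ _ rfl
  filter_upwards [hlim h₁, hlim h₂, Eventually.curry_nhds (x := (0 : ℂ)) (y := (0 : ℂ))
    (hswap.eventually hC)] with χ h1 h2 h3
  have := tendsto_nhds_unique h1 (h2.congr' ((h3.filter_mono nhdsWithin_le_nhds).mono
    fun z hz => congrArg (· / z ^ a) hz.symm))
  rw [hFz] at this
  exact mul_left_cancel₀ (pow_ne_zero _ hl) this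

/-- Finite type case: the leading coefficient in `x` of `Q'(x, y, 0)` takes the same values along
two maps with the same derivatives at the origin. -/
lemma SendsInto.leading_eq_of_finiteType (hQ : IsNormalCoord Q) (hQ' : IsNormalCoord Q')
    (h₁ : SendsInto Q Q' F₁ G₁) (h₂ : SendsInto Q Q' F₂ G₂)
    (hb₁ : JacDet F₁ G₁ ≠ 0) (hb₂ : JacDet F₂ G₂ ≠ 0)
    (hFz : pd F₁ 1 0 0 0 = pd F₂ 1 0 0 0) (hFw : pd F₁ 0 1 0 0 = pd F₂ 0 1 0 0)
    (hGw : pd G₁ 0 1 0 0 = pd G₂ 0 1 0 0) {a : ℕ} {S : ℂ × ℂ → ℂ}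
    (hSc : ∀ᶠ q in 𝓝 0, ContinuousAt S q)
    (hS : ∀ᶠ q : ℂ × ℂ in 𝓝 0, Q' q.2 q.1 0 = q.2 ^ a * S q) :
    ∀ᶠ χ in 𝓝 0, S (cj (F₁ (cj χ) 0), 0) = S (cj (F₂ (cj χ) 0), 0) := by
  obtain ⟨hl, hγ⟩ := h₂.jacobian_ne_zero hQ hQ' hb₂
  have hQan : AnalyticAt ℂ (fun q : ℂ × ℂ => Q q.2 q.1 0) 0 :=
    AnalyticAt.fun_comp (g := fun p : (ℂ × ℂ) × ℂ => Q p.1.1 p.1.2 p.2)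
      (f := fun q : ℂ × ℂ => ((q.2, q.1), (0 : ℂ))) hQ.analyticAt
      ((analyticAt_snd.prod analyticAt_fst).prod analyticAt_const)
  obtain ⟨P, hPc, hP, hP0⟩ := hQan.exists_eq_snd_mul (tendsto_mk_zero.eventually hQ.2.2.1)
  have hP0 : P 0 = 0 := by
    have : (fun z => Q z 0 0) =ᶠ[𝓝 0] fun _ => 0 := tendsto_mk_zero.eventually hQ.2.1
    rw [hP0, this.deriv_eq, deriv_const]
  have hne : ∀ᶠ χ in 𝓝 0, pd F₂ 1 0 0 0 + P (χ, 0) * pd F₂ 0 1 0 0 ≠ 0 := by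
    have : Tendsto (fun χ => pd F₂ 1 0 0 0 + P (χ, 0) * pd F₂ 0 1 0 0) (𝓝 0)
        (𝓝 (pd F₂ 1 0 0 0 + P 0 * pd F₂ 0 1 0 0)) :=
      ((hPc.self_of_nhds.tendsto.comp tendsto_mk_zero).mul_const _).const_add _
    exact this.eventually_ne (by simpa [hP0] using hl)
  filter_upwards [h₁.tendsto_finiteType hQ hQ' hb₁ hSc hS hPc hP,
    h₂.tendsto_finiteType hQ hQ' hb₂ hSc hS hPc hP, hne] with χ h1 h2 h3
  have := tendsto_nhds_unique h1 h2
  rw [hGw, hFz, hFw, div_left_inj' hγ] at this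
  exact mul_left_cancel₀ (pow_ne_zero _ h3) this

end Comparison

end Mapping

/-- a local biholomorphism sending a non-Levi-flat `M` into `M'` is
completely determined along the zero Segre variety `{w = 0}` by its `1`-jet at `0`: two
such maps with the same Jacobian matrix at `0` agree on `{w = 0}` near `0`. -/
theorem one_jet_determines_on_segre
    (Q Q' : ℂ → ℂ → ℂ → ℂ) (hQ : IsNormalCoord Q) (hQ' : IsNormalCoord Q')
    (hLF : NotLeviFlat Q) (hLF' : NotLeviFlat Q')
    (F₁ G₁ F₂ G₂ : ℂ → ℂ → ℂ)
    (h₁ : SendsInto Q Q' F₁ G₁) (h₂ : SendsInto Q Q' F₂ G₂)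
    (hb₁ : JacDet F₁ G₁ ≠ 0) (hb₂ : JacDet F₂ G₂ ≠ 0)
    (hFz : pd F₁ 1 0 0 0 = pd F₂ 1 0 0 0) (hFw : pd F₁ 0 1 0 0 = pd F₂ 0 1 0 0)
    (hGz : pd G₁ 1 0 0 0 = pd G₂ 1 0 0 0) (hGw : pd G₁ 0 1 0 0 = pd G₂ 0 1 0 0) :
    ∀ᶠ z : ℂ in 𝓝 0, F₁ z 0 = F₂ z 0 ∧ G₁ z 0 = G₂ z 0 := by
  have hAan : AnalyticAt ℂ (fun q : (ℂ × ℂ) × ℂ => Q' q.1.1 q.1.2 q.2 - q.2) 0 :=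
    hQ'.analyticAt.sub analyticAt_snd
  have hAne : ¬ ∀ᶠ q : (ℂ × ℂ) × ℂ in 𝓝 0, Q' q.1.1 q.1.2 q.2 - q.2 = 0 := fun hev =>
    hLF' (((Continuous.tendsto' (f := fun p : ℂ × ℂ × ℂ => ((p.1, p.2.1), p.2.2))
      (by fun_prop) 0 0 rfl).eventually hev).mono fun p hp => sub_eq_zero.1 hp)
  obtain ⟨m, B, hBc, hB, hCan, hCne⟩ := hAan.exists_eq_snd_pow_mul hAne
  have hswap : Tendsto (fun q : ℂ × ℂ => (q.2, q.1)) (𝓝 0) (𝓝 0) :=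
    Continuous.tendsto' (by fun_prop) _ _ rfl
  have hDan : AnalyticAt ℂ (fun q : ℂ × ℂ => B ((q.2, q.1), 0)) 0 :=
    AnalyticAt.fun_comp (g := fun p : ℂ × ℂ => B (p, 0)) (f := fun q : ℂ × ℂ => (q.2, q.1)) hCan
      (analyticAt_snd.prod analyticAt_fst)
  obtain ⟨a, S, hSc, hS, hsan, hsne⟩ :=
    hDan.exists_eq_snd_pow_mul fun hev => hCne (hswap.eventually hev)
  have hs0 : S (0, 0) = 0 := by
    refine ContinuousAt.eq_zero_of_eventually_punctured (g := fun x => S (0, x)) (x := (0 : ℂ))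
      (ContinuousAt.comp' (g := S) hSc.self_of_nhds (by fun_prop)) ?_
    filter_upwards [(hQ'.leading_coeff_axes hBc hB).1.filter_mono nhdsWithin_le_nhds,
      (tendsto_zero_mk.eventually hS).filter_mono nhdsWithin_le_nhds, self_mem_nhdsWithin]
      with x h1 h2 hx
    rw [h1] at h2
    exact (mul_eq_zero.1 h2.symm).resolve_left (pow_ne_zero _ hx)
  have hkey : ∀ᶠ χ in 𝓝 0, S (cj (F₁ (cj χ) 0), 0) = S (cj (F₂ (cj χ) 0), 0) := by
    rcases eq_or_ne m 0 with rfl | hm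
    · refine h₁.leading_eq_of_finiteType hQ hQ' h₂ hb₁ hb₂ hFz hFw hGw (a := a) hSc ?_
      filter_upwards [hS, (hswap.prodMk_nhds (tendsto_const_nhds (x := (0 : ℂ)))).eventually hB] with q h1 h2
      simpa [h1] using h2
    · exact h₁.leading_eq_of_infiniteType hQ hQ' h₂ hb₁ hb₂ hFz hGw hm hBc hB hSc hS
  have hl : cj (pd F₂ 1 0 0 0) ≠ 0 := fun h0 =>
    (h₂.jacobian_ne_zero hQ hQ' hb₂).1 (cj_injective (h0.trans cj_zero.symm))
  have hF := tendsto_cj_punctured.eventually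
    (hsan.eventuallyEq_of_comp_eq hs0 hsne hl (hFz ▸ tendsto_div_conj_segre h₁.1 h₁.2.2.1)
      (tendsto_div_conj_segre h₂.1 h₂.2.2.1) (hkey.filter_mono nhdsWithin_le_nhds))
  filter_upwards [eventually_nhdsWithin_iff.1 hF, h₁.eventually_snd_apply_zero hQ hQ',
    h₂.eventually_snd_apply_zero hQ hQ'] with z h1 h2 h3
  refine ⟨?_, h2.trans h3.symm⟩
  rcases eq_or_ne z 0 with rfl | hz
  · rw [h₁.2.2.1, h₂.2.2.1]
  · simpa using cj_injective (h1 hz)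
end
end

section
/- Let Q be a normal-coordinates function for a germ at 0 of a real-analytic hypersurface M ⊂ ℂ² of finite type at 0, with invariant β₀ and expansion coefficients r_β, and set u(z,χ) := ∂_zQ(z, χ, Q̄(χ,z,0)) and r̄_{β₀}(z,τ) := conj(r_{β₀}(conj z, conj τ)). Then for every z₀ ≠ 0 near 0 with ∂_z r̄_{β₀}(z₀,0) ≠ 0 there exists a holomorphic function ψ(z,χ) defined on a neighborhood of (z₀,0) in ℂ² such that u(z,χ) = ψ(z,χ)^{β₀}, ψ(z,0) = 0, and ∂_χψ(z,0) ≠ 0 for all z near z₀. -/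
open Filter Topology Matrix

noncomputable section

/-- `Q̄(χ, z, w) = conj(Q(conj χ, conj z, conj w))`. -/
def Qbar (Q : ℂ → ℂ → ℂ → ℂ) (χ z w : ℂ) : ℂ := cj (Q (cj χ) (cj z) (cj w))

/-- `u(z, χ) = ∂_zQ(z, χ, Q̄(χ, z, 0))`. -/
def useg (Q : ℂ → ℂ → ℂ → ℂ) (z χ : ℂ) : ℂ :=
  deriv (fun z' => Q z' χ (Qbar Q χ z 0)) z

/-- The Taylor coefficient `r_β(χ, τ)` in the expansion `Q(z,χ,τ) = τ + Σ_{β≥1} r_β(χ,τ) z^β`. -/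
def rc (Q : ℂ → ℂ → ℂ → ℂ) (β : ℕ) (χ τ : ℂ) : ℂ :=
  deriv^[β] (fun z => Q z χ τ) 0 / (Nat.factorial β : ℂ)

/-- `β₀` is the invariant of the finite type hypersurface defined by `Q`:
`β₀ = min{β ≥ 1 : r_β(·, 0) ≢ 0}`. -/
def IsBeta0 (Q : ℂ → ℂ → ℂ → ℂ) (β₀ : ℕ) : Prop :=
  1 ≤ β₀ ∧ (¬ ∀ᶠ χ : ℂ in 𝓝 0, rc Q β₀ χ 0 = 0) ∧
  ∀ β : ℕ, 1 ≤ β → β < β₀ → ∀ᶠ χ : ℂ in 𝓝 0, rc Q β χ 0 = 0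

/-- The formal multilinear series of `(f - f ∘ π) / χ`, where `p` is the series of `f` and
`π (z, χ) = (z, 0)`; its terms come from telescoping `pₙ(v, …, v) - pₙ(π v, …, π v)`. -/
def sndDivSeries (p : FormalMultilinearSeries ℂ (ℂ × ℂ) ℂ) :
    FormalMultilinearSeries ℂ (ℂ × ℂ) ℂ := fun n =>
  ∑ i : Fin (n + 1), ((p (n + 1)).curryMid i ((0 : ℂ), (1 : ℂ))).compContinuousLinearMap
    (fun j => if i.succAbove j < i then ContinuousLinearMap.id ℂ (ℂ × ℂ)
      else (ContinuousLinearMap.inl ℂ ℂ ℂ).comp (ContinuousLinearMap.fst ℂ ℂ ℂ))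

theorem norm_sndDivSeries_le (p : FormalMultilinearSeries ℂ (ℂ × ℂ) ℂ) (n : ℕ) :
    ‖sndDivSeries p n‖ ≤ (n + 1) * ‖p (n + 1)‖ := by
  have hπ : ‖(ContinuousLinearMap.inl ℂ ℂ ℂ).comp (ContinuousLinearMap.fst ℂ ℂ ℂ)‖ ≤ 1 := by
    refine ContinuousLinearMap.opNorm_le_bound _ zero_le_one fun x => ?_
    simp [Prod.norm_def]
  refine (norm_sum_le _ _).trans ?_
  have key : ∀ i ∈ (Finset.univ : Finset (Fin (n + 1))),
      ‖((p (n + 1)).curryMid i ((0 : ℂ), (1 : ℂ))).compContinuousLinearMap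
        (fun j => if i.succAbove j < i then ContinuousLinearMap.id ℂ (ℂ × ℂ)
        else (ContinuousLinearMap.inl ℂ ℂ ℂ).comp (ContinuousLinearMap.fst ℂ ℂ ℂ))‖
      ≤ ‖p (n + 1)‖ := by
    intro i _
    refine (ContinuousMultilinearMap.norm_compContinuousLinearMap_le _ _).trans ?_
    have h1 : ‖(p (n + 1)).curryMid i ((0 : ℂ), (1 : ℂ))‖ ≤ ‖p (n + 1)‖ := by
      refine (ContinuousLinearMap.le_opNorm _ _).trans ?_
      rw [ContinuousMultilinearMap.norm_curryMid]
      simp [Prod.norm_def]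
    refine (mul_le_mul h1 (Finset.prod_le_one (fun _ _ => norm_nonneg _) fun j _ => ?_)
      (Finset.prod_nonneg fun _ _ => norm_nonneg _) (norm_nonneg _)).trans (mul_one _).le
    split_ifs
    · exact ContinuousLinearMap.norm_id_le
    · exact hπ
  refine (Finset.sum_le_sum key).trans ?_
  simp

theorem snd_mul_sndDivSeries (p : FormalMultilinearSeries ℂ (ℂ × ℂ) ℂ) (n : ℕ) (v : ℂ × ℂ) :
    p (n + 1) (fun _ => v) - p (n + 1) (fun _ => (v.1, 0)) =
      v.2 * sndDivSeries p n (fun _ => v) := by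
  have h := (p (n + 1)).toMultilinearMap.map_sub_map_piecewise
    (fun _ => v) (fun _ => (v.1, (0 : ℂ))) Finset.univ
  rw [Finset.piecewise_univ] at h
  simp only [ContinuousMultilinearMap.coe_coe] at h
  rw [h, sndDivSeries, _root_.sum_apply, Finset.mul_sum]
  refine Finset.sum_congr rfl fun i _ => ?_
  rw [ContinuousMultilinearMap.compContinuousLinearMap_apply,
    ContinuousMultilinearMap.curryMid_apply, ← smul_eq_mul]
  set m : Fin n → ℂ × ℂ := fun j => (if i.succAbove j < i then ContinuousLinearMap.id ℂ (ℂ × ℂ)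
      else (ContinuousLinearMap.inl ℂ ℂ ℂ).comp (ContinuousLinearMap.fst ℂ ℂ ℂ)) v with hm
  have h2 := (p (n + 1)).map_update_smul (i.insertNth ((0 : ℂ), (1 : ℂ)) m) i v.2 ((0 : ℂ), (1 : ℂ))
  rw [Fin.update_insertNth, Fin.update_insertNth] at h2
  rw [← h2]
  congr 1
  funext j
  induction j using Fin.succAboveCases i with
  | x => simp [Prod.ext_iff]
  | p j =>
    simp only [Finset.mem_univ, forall_true_left, Fin.insertNth_apply_succAbove, hm]
    split_ifs with h1 h2
    · rfl
    · exact absurd h2 (Fin.succAbove_ne i j).symm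
    · rfl

theorem radius_sndDivSeries_pos {p : FormalMultilinearSeries ℂ (ℂ × ℂ) ℂ} (hp : 0 < p.radius) :
    0 < (sndDivSeries p).radius := by
  obtain ⟨r, hr0, hr⟩ := ENNReal.lt_iff_exists_nnreal_btwn.1 hp
  obtain ⟨C, hC, hb⟩ := p.norm_mul_pow_le_of_lt_radius hr
  have hr0' : 0 < r := by exact_mod_cast hr0
  have hr0'' : (0 : ℝ) < r := by exact_mod_cast hr0
  have : ((r / 2 : NNReal) : ENNReal) ≤ (sndDivSeries p).radius := by
    refine FormalMultilinearSeries.le_radius_of_bound _ (C / r) fun n => ?_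
    have h1 : ((n : ℝ) + 1) ≤ 2 ^ n := by exact_mod_cast Nat.lt_two_pow_self (n := n)
    have h2 : ‖p (n + 1)‖ * (r : ℝ) ^ n ≤ C / r := by
      rw [le_div_iff₀ hr0'', mul_assoc, ← pow_succ]
      exact hb (n + 1)
    push_cast
    rw [div_pow]
    calc ‖sndDivSeries p n‖ * ((r : ℝ) ^ n / 2 ^ n)
        ≤ (((n : ℝ) + 1) * ‖p (n + 1)‖) * ((r : ℝ) ^ n / 2 ^ n) := by
          gcongr; exact norm_sndDivSeries_le p n
      _ = (((n : ℝ) + 1) / 2 ^ n) * (‖p (n + 1)‖ * (r : ℝ) ^ n) := by ring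
      _ ≤ 1 * (C / r) := by
          gcongr
          exact (div_le_one (by positivity)).2 h1
      _ = C / r := one_mul _
  exact lt_of_lt_of_le (by exact_mod_cast half_pos hr0') this

/-- Hadamard's lemma for holomorphic functions of two variables. -/
theorem AnalyticAt.exists_eq_add_snd_mul {F : ℂ × ℂ → ℂ} (hF : AnalyticAt ℂ F 0) :
    ∃ g : ℂ × ℂ → ℂ, AnalyticAt ℂ g 0 ∧ ∀ᶠ p in 𝓝 (0 : ℂ × ℂ), F p = F (p.1, 0) + p.2 * g p := by
  obtain ⟨p, r, hp⟩ := hF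
  have hq := (sndDivSeries p).hasFPowerSeriesOnBall
    (radius_sndDivSeries_pos (hp.r_pos.trans_le hp.r_le))
  refine ⟨_, hq.analyticAt, ?_⟩
  filter_upwards [Metric.eball_mem_nhds (0 : ℂ × ℂ) hp.r_pos,
    Metric.eball_mem_nhds (0 : ℂ × ℂ) hq.r_pos] with v hv hv'
  have hv0 : (v.1, (0 : ℂ)) ∈ Metric.eball (0 : ℂ × ℂ) r := by
    refine Metric.mem_eball.2 (lt_of_le_of_lt ?_ (Metric.mem_eball.1 hv))
    rw [edist_zero_right, edist_zero_right, enorm_le_iff_norm_le]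
    simp [Prod.norm_def]
  have h1 := hp.hasSum hv
  have h2 := hp.hasSum hv0
  have h3 := (hq.hasSum hv').mul_left v.2
  simp only [zero_add] at h1 h2 h3
  have h4 := h1.sub h2
  rw [← hasSum_nat_add_iff' 1] at h4
  simp only [snd_mul_sndDivSeries] at h4
  have h5 := h4.unique h3
  have h0 : (p 0) (fun _ => v) = (p 0) (fun _ => (v.1, (0 : ℂ))) :=
    congrArg _ (Subsingleton.elim _ _)
  simp only [Finset.sum_range_one, h0, sub_self, sub_zero] at h5
  linear_combination h5

theorem iteratedDeriv_succ_id_mul {γ : ℂ → ℂ} (hγ : AnalyticAt ℂ γ 0) (n : ℕ) :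
    ∀ᶠ x in 𝓝 (0 : ℂ), iteratedDeriv (n + 1) (fun x => x * γ x) x =
      x * iteratedDeriv (n + 1) γ x + (n + 1) * iteratedDeriv n γ x := by
  have hd : ∀ k, ∀ᶠ x in 𝓝 (0 : ℂ), DifferentiableAt ℂ (iteratedDeriv k γ) x := fun k => by
    rw [iteratedDeriv_eq_iterate]
    exact (hγ.iterated_deriv k).eventually_analyticAt.mono fun _ h => h.differentiableAt
  induction n with
  | zero =>
    filter_upwards [hd 0] with x hx
    simp only [zero_add, iteratedDeriv_one, iteratedDeriv_zero] at hx ⊢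
    rw [deriv_fun_mul differentiableAt_fun_id hx]
    simp; ring
  | succ n ih =>
    filter_upwards [ih.eventually_nhds, hd n, hd (n + 1)] with x hx h1 h2
    rw [iteratedDeriv_succ, EventuallyEq.deriv_eq hx,
      deriv_fun_add (differentiableAt_fun_id.fun_mul h2) (h1.const_mul _),
      deriv_fun_mul differentiableAt_fun_id h2, deriv_const_mul _ h1, iteratedDeriv_succ (n := n + 1),
      iteratedDeriv_succ (n := n)]
    simp; ring

theorem eventually_nhds_prod_mk_zero {P : ℂ × ℂ → Prop} (h : ∀ᶠ p in 𝓝 (0 : ℂ × ℂ), P p) :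
    ∀ᶠ z in 𝓝 (0 : ℂ), P (z, 0) := by
  have : Tendsto (fun z : ℂ => (z, (0 : ℂ))) (𝓝 0) (𝓝 (0 : ℂ × ℂ)) :=
    Continuous.tendsto' (by fun_prop) _ _ rfl
  exact this.eventually h

theorem AnalyticAt.exists_eq_snd_pow_mul_s18 (k : ℕ) {F : ℂ × ℂ → ℂ} (hF : AnalyticAt ℂ F 0)
    (h : ∀ j < k, ∀ᶠ z in 𝓝 (0 : ℂ), iteratedDeriv j (fun x => F (z, x)) 0 = 0) :
    ∃ g : ℂ × ℂ → ℂ, AnalyticAt ℂ g 0 ∧ (∀ᶠ p in 𝓝 (0 : ℂ × ℂ), F p = p.2 ^ k * g p) ∧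
      ∀ᶠ z in 𝓝 (0 : ℂ), iteratedDeriv k (fun x => F (z, x)) 0 = k.factorial * g (z, 0) := by
  induction k generalizing F with
  | zero => exact ⟨F, hF, by simp, by simp⟩
  | succ k ih =>
    obtain ⟨g, hg, hFg⟩ := hF.exists_eq_add_snd_mul
    have h0 : ∀ᶠ z in 𝓝 (0 : ℂ), F (z, 0) = 0 := by simpa using h 0 k.succ_pos
    have hFg' : ∀ᶠ p in 𝓝 (0 : ℂ × ℂ), F p = p.2 * g p := by
      have : Tendsto Prod.fst (𝓝 (0 : ℂ × ℂ)) (𝓝 (0 : ℂ)) := continuous_fst.tendsto' _ _ rfl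
      filter_upwards [hFg, this.eventually h0] with p h1 h2
      rw [h1, h2, zero_add]
    have hder : ∀ j, ∀ᶠ z in 𝓝 (0 : ℂ), iteratedDeriv (j + 1) (fun x => F (z, x)) 0 =
        (j + 1) * iteratedDeriv j (fun x => g (z, x)) 0 := fun j => by
      filter_upwards [eventually_nhds_prod_mk_zero hFg'.eventually_nhds,
        eventually_nhds_prod_mk_zero hg.eventually_analyticAt] with z hz hgz
      have hc : Tendsto (fun x : ℂ => (z, x)) (𝓝 0) (𝓝 (z, 0)) :=
        Continuous.tendsto (by fun_prop : Continuous fun x : ℂ => (z, x)) 0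
      have h1 : (fun x => F (z, x)) =ᶠ[𝓝 0] fun x => x * g (z, x) := hc.eventually hz
      rw [h1.iteratedDeriv_eq]
      have := (iteratedDeriv_succ_id_mul (γ := fun x => g (z, x))
        (hgz.comp_of_eq (by fun_prop) rfl) j).self_of_nhds
      simpa using this
    obtain ⟨G, hG, hgG, hGd⟩ := ih hg fun j hj => by
      filter_upwards [h (j + 1) (by omega), hder j] with z h1 h2
      rw [h1] at h2
      exact (mul_eq_zero.1 h2.symm).resolve_left (by exact_mod_cast j.succ_ne_zero)
    refine ⟨G, hG, ?_, ?_⟩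
    · filter_upwards [hFg', hgG] with p h1 h2
      rw [h1, h2]; ring
    · filter_upwards [hder k, hGd] with z h1 h2
      rw [h1, h2, Nat.factorial_succ]; push_cast; ring

/-- The conjugate `v ↦ conj (p (conj v))` of a continuous multilinear map. -/
def ContinuousMultilinearMap.starConj {E : Type*} [NormedAddCommGroup E] [NormedSpace ℂ E]
    [StarAddMonoid E] [NormedStarGroup E] [StarModule ℂ E] {n : ℕ}
    (p : ContinuousMultilinearMap ℂ (fun _ : Fin n => E) ℂ) :
    ContinuousMultilinearMap ℂ (fun _ : Fin n => E) ℂ :=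
  MultilinearMap.mkContinuous
    { toFun := fun v => star (p fun i => star (v i))
      map_update_add' := fun v i x y => by
        have h : ∀ x, (fun j => star (Function.update v i x j)) =
            Function.update (fun j => star (v j)) i (star x) := fun x => by
          funext j; by_cases hj : j = i
          · subst hj; simp
          · simp [hj]
        convert congrArg star (p.map_update_add (fun j => star (v j)) i (star x) (star y)) using 2
        all_goals simp [h]
      map_update_smul' := fun v i c x => by
        have h : ∀ x, (fun j => star (Function.update v i x j)) =
            Function.update (fun j => star (v j)) i (star x) := fun x => by
          funext j; by_cases hj : j = i
          · subst hj; simp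
          · simp [hj]
        convert congrArg star (p.map_update_smul (fun j => star (v j)) i (star c) (star x)) using 2
        all_goals simp [h] }
    ‖p‖ fun v => by
      simpa using p.le_opNorm fun i => star (v i)

/-- If `f` is holomorphic, so is `x ↦ conj (f (conj x))`. -/
theorem AnalyticAt.star_comp_star {E : Type*} [NormedAddCommGroup E] [NormedSpace ℂ E]
    [StarAddMonoid E] [NormedStarGroup E] [StarModule ℂ E] {f : E → ℂ} (hf : AnalyticAt ℂ f 0) :
    AnalyticAt ℂ (fun x => star (f (star x))) 0 := by
  obtain ⟨p, r, hp⟩ := hf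
  refine ⟨fun n => (p n).starConj, r, ?_, hp.r_pos, fun {y} hy => ?_⟩
  · refine hp.r_le.trans (FormalMultilinearSeries.radius_le_of_le fun n => ?_)
    exact MultilinearMap.mkContinuous_norm_le _ (norm_nonneg _) _
  · have hy' : star y ∈ Metric.eball (0 : E) r := by
      simpa [← ofReal_norm] using hy
    simpa [ContinuousMultilinearMap.starConj] using (hp.hasSum hy').star

/-- Chain rule along the graph `τ = f z`, on which `q` vanishes. -/
theorem deriv_fst_eq_neg_of_vanishing {q : ℂ × ℂ × ℂ → ℂ} {f : ℂ → ℂ} {z χ : ℂ}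
    (hq : DifferentiableAt ℂ q (z, χ, f z)) (hf : DifferentiableAt ℂ f z)
    (h : ∀ᶠ z' in 𝓝 z, q (z', χ, f z') = 0) :
    deriv (fun z' => q (z', χ, f z)) z = -(fderiv ℂ q (z, χ, f z) (0, 0, 1) * deriv f z) := by
  have h1 : HasDerivAt (fun z' => q (z', χ, f z)) (fderiv ℂ q (z, χ, f z) (1, 0, 0)) z :=
    HasFDerivAt.comp_hasDerivAt (f := fun z' => (z', χ, f z)) z hq.hasFDerivAt
      ((hasDerivAt_id z).prodMk ((hasDerivAt_const z χ).prodMk (hasDerivAt_const z (f z))))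
  have h2 : HasDerivAt (fun z' => q (z', χ, f z')) (fderiv ℂ q (z, χ, f z) (1, 0, deriv f z)) z :=
    HasFDerivAt.comp_hasDerivAt (f := fun z' => (z', χ, f z')) z hq.hasFDerivAt
      ((hasDerivAt_id z).prodMk ((hasDerivAt_const z χ).prodMk hf.hasDerivAt))
  have h3 : fderiv ℂ q (z, χ, f z) (1, 0, deriv f z) = 0 :=
    (h2.congr_of_eventuallyEq (f₁ := fun _ => 0) (h.mono fun _ h => h.symm)).unique
      (hasDerivAt_const z (0 : ℂ))
  have h4 : ((1 : ℂ), (0 : ℂ), deriv f z) =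
      ((1 : ℂ), (0 : ℂ), (0 : ℂ)) + deriv f z • ((0 : ℂ), (0 : ℂ), (1 : ℂ)) := by
    simp
  rw [h4, map_add, map_smul, smul_eq_mul] at h3
  rw [h1.deriv]
  linear_combination h3

/-- If `u = χ ^ n * v` near `(z₀, 0)` with `v (z₀, 0) ≠ 0`, then `u` has a holomorphic `n`-th root
near `(z₀, 0)` which vanishes to order exactly one along `χ = 0`. -/
theorem exists_root_of_eq_snd_pow_mul {u v : ℂ × ℂ → ℂ} {z₀ : ℂ} {n : ℕ} (hn : n ≠ 0)
    (hv : AnalyticAt ℂ v (z₀, 0)) (hv0 : v (z₀, 0) ≠ 0)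
    (hu : ∀ᶠ p in 𝓝 (z₀, (0 : ℂ)), u p = p.2 ^ n * v p) :
    ∃ (W : Set (ℂ × ℂ)) (ψ : ℂ × ℂ → ℂ),
      IsOpen W ∧ (z₀, (0 : ℂ)) ∈ W ∧ AnalyticOnNhd ℂ ψ W ∧ (∀ p ∈ W, u p = ψ p ^ n) ∧
      ∀ᶠ z : ℂ in 𝓝 z₀, ψ (z, 0) = 0 ∧ deriv (fun χ => ψ (z, χ)) 0 ≠ 0 := by
  set c := v (z₀, 0) with hc
  set h : ℂ × ℂ → ℂ := fun p => c ^ (n⁻¹ : ℂ) * (v p / c) ^ (n⁻¹ : ℂ) with hh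
  have hpow : ∀ p, h p ^ n = v p := fun p => by
    rw [hh]
    simp only
    rw [mul_pow, Complex.cpow_nat_inv_pow _ hn, Complex.cpow_nat_inv_pow _ hn, mul_div_cancel₀ _ hv0]
  have hha : AnalyticAt ℂ h (z₀, 0) := by
    refine analyticAt_const.mul (AnalyticAt.cpow (hv.div analyticAt_const hv0) analyticAt_const ?_)
    rw [← hc, div_self hv0]
    exact Complex.one_mem_slitPlane
  obtain ⟨W, hW, hWo, hzW⟩ := eventually_nhds_iff.1
    ((hha.eventually_analyticAt.and (hv.continuousAt.eventually_ne hv0)).and hu)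
  refine ⟨W, fun p => p.2 * h p, hWo, hzW, fun p hp => analyticAt_snd.mul (hW p hp).1.1,
    fun p hp => ?_, ?_⟩
  · rw [(hW p hp).2, mul_pow, hpow]
  · have ht : Tendsto (fun z : ℂ => (z, (0 : ℂ))) (𝓝 z₀) (𝓝 (z₀, 0)) :=
      Continuous.tendsto (by fun_prop : Continuous fun z : ℂ => (z, (0 : ℂ))) z₀
    filter_upwards [ht.eventually (hWo.mem_nhds hzW)] with z hz
    refine ⟨by simp, ?_⟩
    have hd : DifferentiableAt ℂ (fun χ => h (z, χ)) 0 :=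
      ((hW _ hz).1.1.comp_of_eq (f := fun χ : ℂ => (z, χ)) (by fun_prop) rfl).differentiableAt
    have hne : h (z, 0) ≠ 0 := fun h0 => (hW _ hz).1.2 (by rw [← hpow, h0, zero_pow hn])
    simpa [deriv_fun_mul differentiableAt_fun_id hd] using hne

theorem Qbar_eq_pow_mul {Q : ℂ → ℂ → ℂ → ℂ} (hQ : IsNormalCoord Q) {β₀ : ℕ} (hB : IsBeta0 Q β₀) :
    ∃ g : ℂ × ℂ → ℂ, AnalyticAt ℂ g 0 ∧
      (∀ᶠ p in 𝓝 (0 : ℂ × ℂ), Qbar Q p.2 p.1 0 = p.2 ^ β₀ * g p) ∧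
      ∀ᶠ z in 𝓝 (0 : ℂ), g (z, 0) = cj (rc Q β₀ (cj z) 0) := by
  have hF : AnalyticAt ℂ (fun p : ℂ × ℂ => Q p.2 p.1 0) 0 :=
    hQ.1.comp_of_eq (f := fun p : ℂ × ℂ => (p.2, p.1, (0 : ℂ)))
      (analyticAt_snd.prod (analyticAt_fst.prod analyticAt_const)) rfl
  obtain ⟨G, hG, hFG, hGd⟩ := hF.exists_eq_snd_pow_mul_s18 β₀ fun j hj => by
    rcases Nat.eq_zero_or_pos j with rfl | hj0
    · simpa using eventually_nhds_prod_mk_zero hQ.2.2.1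
    · filter_upwards [hB.2.2 j hj0 hj] with z hz
      rw [iteratedDeriv_eq_iterate]
      exact (div_eq_zero_iff.1 hz).resolve_right (by exact_mod_cast j.factorial_ne_zero)
  have hs : Tendsto (star : ℂ × ℂ → ℂ × ℂ) (𝓝 0) (𝓝 0) :=
    continuous_star.tendsto' _ _ (star_zero _)
  have hs1 : Tendsto (star : ℂ → ℂ) (𝓝 0) (𝓝 0) := continuous_star.tendsto' _ _ (star_zero _)
  refine ⟨_, hG.star_comp_star, ?_, ?_⟩
  · filter_upwards [hs.eventually hFG] with p hp
    have := congrArg star hp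
    rw [star_mul', star_pow] at this
    simpa [Qbar, cj] using this
  · filter_upwards [hs1.eventually hGd] with z hz
    rw [iteratedDeriv_eq_iterate] at hz
    have : rc Q β₀ (star z) 0 = G (star z, 0) := by
      rw [rc, hz, mul_div_cancel_left₀ _ (by exact_mod_cast β₀.factorial_ne_zero)]
    change star (G (star z, star 0)) = star (rc Q β₀ (star z) 0)
    rw [this, star_zero]

theorem useg_eq_pow_mul {Q : ℂ → ℂ → ℂ → ℂ} (hQ : IsNormalCoord Q) {β₀ : ℕ} (hB : IsBeta0 Q β₀) :
    ∃ v : ℂ × ℂ → ℂ, AnalyticAt ℂ v 0 ∧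
      (∀ᶠ p in 𝓝 (0 : ℂ × ℂ), useg Q p.1 p.2 = p.2 ^ β₀ * v p) ∧
      ∀ᶠ z in 𝓝 (0 : ℂ), v (z, 0) = -deriv (fun z' => cj (rc Q β₀ (cj z') 0)) z := by
  obtain ⟨g, hg, hfg, hgr⟩ := Qbar_eq_pow_mul hQ hB
  set q : ℂ × ℂ × ℂ → ℂ := fun p => Q p.1 p.2.1 p.2.2 with hq
  have hβ : β₀ ≠ 0 := Nat.one_le_iff_ne_zero.1 hB.1
  set φ : ℂ × ℂ → ℂ × ℂ × ℂ := fun p => (p.1, p.2, p.2 ^ β₀ * g p) with hφ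
  have hφa : AnalyticAt ℂ φ 0 :=
    analyticAt_fst.prod (analyticAt_snd.prod ((analyticAt_snd.pow _).mul hg))
  have hφ0 : φ 0 = 0 := by simp [hφ, hβ]
  have hφt : Tendsto φ (𝓝 0) (𝓝 0) := hφ0 ▸ hφa.continuousAt.tendsto
  have hqd : AnalyticAt ℂ (fun p => fderiv ℂ q (φ p) (0, 0, 1)) 0 :=
    (ContinuousLinearMap.apply ℂ ℂ ((0 : ℂ), (0 : ℂ), (1 : ℂ))).analyticAt _ |>.comp
      (hQ.1.fderiv.comp_of_eq hφa hφ0)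
  have hgd : AnalyticAt ℂ (fun p => fderiv ℂ g p (1, 0)) 0 :=
    (ContinuousLinearMap.apply ℂ ℂ ((1 : ℂ), (0 : ℂ))).analyticAt _ |>.comp hg.fderiv
  have hgderiv : ∀ p : ℂ × ℂ, AnalyticAt ℂ g p →
      HasDerivAt (fun z' => g (z', p.2)) (fderiv ℂ g p (1, 0)) p.1 := fun p hp =>
    HasFDerivAt.comp_hasDerivAt (f := fun z' => (z', p.2)) p.1 hp.differentiableAt.hasFDerivAt
      ((hasDerivAt_id p.1).prodMk (hasDerivAt_const p.1 p.2))
  refine ⟨fun p => -(fderiv ℂ q (φ p) (0, 0, 1) * fderiv ℂ g p (1, 0)), (hqd.mul hgd).neg, ?_, ?_⟩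
  · have hreal : ∀ᶠ p in 𝓝 (0 : ℂ × ℂ), q (p.1, p.2, Qbar Q p.2 p.1 0) = 0 := by
      have ht : Tendsto (fun p : ℂ × ℂ => (p.1, p.2, (0 : ℂ))) (𝓝 0) (𝓝 0) :=
        Continuous.tendsto' (by fun_prop) _ _ rfl
      exact ht.eventually hQ.2.2.2
    filter_upwards [(hreal.and hfg).eventually_nhds, hg.eventually_analyticAt,
      hφt.eventually hQ.1.eventually_analyticAt] with p hp hgp hqp
    have ht : Tendsto (fun z' : ℂ => (z', p.2)) (𝓝 p.1) (𝓝 p) :=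
      Continuous.tendsto (by fun_prop : Continuous fun z' : ℂ => (z', p.2)) p.1
    have hd := (hgderiv p hgp).const_mul (p.2 ^ β₀)
    have key := deriv_fst_eq_neg_of_vanishing (q := q) (χ := p.2)
      (f := fun z' => p.2 ^ β₀ * g (z', p.2)) (z := p.1) hqp.differentiableAt hd.differentiableAt
      ((ht.eventually hp).mono fun z' h => by
        have := h.1
        rwa [h.2] at this)
    rw [useg, hp.self_of_nhds.2]
    rw [hd.deriv] at key
    refine key.trans ?_
    simp only [hφ]
    ring
  · have hτ : ∀ᶠ z in 𝓝 (0 : ℂ), ∀ᶠ τ in 𝓝 (0 : ℂ), q (z, 0, τ) = τ := by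
      filter_upwards [eventually_nhds_prod_mk_zero hQ.2.1.eventually_nhds] with z hz
      have ht : Tendsto (fun τ : ℂ => (z, τ)) (𝓝 0) (𝓝 (z, 0)) :=
        Continuous.tendsto (by fun_prop : Continuous fun τ : ℂ => (z, τ)) 0
      exact ht.eventually hz
    filter_upwards [hτ, hgr.eventually_nhds, eventually_nhds_prod_mk_zero hg.eventually_analyticAt,
      eventually_nhds_prod_mk_zero (hφt.eventually hQ.1.eventually_analyticAt)] with z h1 h2 h3 h4
    have hφz : φ (z, 0) = (z, 0, 0) := by simp [hφ, hβ]
    rw [hφz] at h4 ⊢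
    have h5 : HasDerivAt (fun τ => q (z, 0, τ)) (fderiv ℂ q (z, 0, 0) (0, 0, 1)) 0 :=
      HasFDerivAt.comp_hasDerivAt (f := fun τ => (z, (0 : ℂ), τ)) 0
        h4.differentiableAt.hasFDerivAt
        ((hasDerivAt_const 0 z).prodMk ((hasDerivAt_const 0 0).prodMk (hasDerivAt_id 0)))
    have h6 : fderiv ℂ q (z, 0, 0) (0, 0, 1) = 1 :=
      (h5.congr_of_eventuallyEq (f₁ := fun τ => τ) (h1.mono fun _ h => h.symm)).unique
        (hasDerivAt_id 0)
    rw [h6, one_mul, ← (hgderiv (z, 0) h3).deriv]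
    exact congrArg _ (EventuallyEq.deriv_eq h2)

/-- identities (35), (36): near every point `z₀ ≠ 0` close to `0` at
which `∂_z r̄_{β₀}(z₀, 0) ≠ 0`, there is a holomorphic `β₀`-th root `ψ(z, χ)` of
`u(z,χ) = ∂_zQ(z,χ,Q̄(χ,z,0))`, with `ψ(z, 0) = 0` and `∂_χψ(z, 0) ≠ 0` for `z` near `z₀`. -/
theorem root_extraction_psi
    (Q : ℂ → ℂ → ℂ → ℂ) (hQ : IsNormalCoord Q) (hFT : FiniteTypeAt Q)
    (β₀ : ℕ) (hB : IsBeta0 Q β₀) :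
    ∃ ε > (0 : ℝ), ∀ z₀ : ℂ, z₀ ≠ 0 → ‖z₀‖ < ε →
      deriv (fun z' => cj (rc Q β₀ (cj z') 0)) z₀ ≠ 0 →
      ∃ (W : Set (ℂ × ℂ)) (ψ : ℂ × ℂ → ℂ),
        IsOpen W ∧ (z₀, (0 : ℂ)) ∈ W ∧ AnalyticOnNhd ℂ ψ W ∧
        (∀ p ∈ W, useg Q p.1 p.2 = ψ p ^ β₀) ∧
        ∀ᶠ z : ℂ in 𝓝 z₀, ψ (z, 0) = 0 ∧ deriv (fun χ => ψ (z, χ)) 0 ≠ 0 := by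
  obtain ⟨v, hv, huv, hvd⟩ := useg_eq_pow_mul hQ hB
  obtain ⟨ε, hε, hball⟩ := Metric.eventually_nhds_iff_ball.1
    ((eventually_nhds_prod_mk_zero (hv.eventually_analyticAt.and huv.eventually_nhds)).and hvd)
  refine ⟨ε, hε, fun z₀ _ hz₀ hne => ?_⟩
  obtain ⟨⟨ha, hu⟩, hd⟩ := hball z₀ (by simpa using hz₀)
  exact exists_root_of_eq_snd_pow_mul (u := fun p => useg Q p.1 p.2)
    (Nat.one_le_iff_ne_zero.1 hB.1) ha (by rw [hd]; exact neg_ne_zero.2 hne) hu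
end
end
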